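/- Assume p ≥ 2. Let K̃ be a symmetric measurable kernel with Λ⁻¹|x−y|^{−(n+sp)} ≤ K̃(x,y) ≤ Λ|x−y|^{−(n+sp)} for x ≠ y, μ ∈ C_0^∞(ℝⁿ), let u ∈ W^{s,p}(ℝⁿ) be a weak solution of the kernel-K̃ fractional p-Laplace equation with datum μ in B_{2r}, and let v ∈ W^{s,p}(ℝⁿ) solve the homogeneous kernel-K̃ equation in B_r with v = u a.e. in ℝⁿ∖B_r; set w := u − v. Let h ∈ (0,s) and q ∈ [1, q̄) where q̄ := min{n(p−1)/(n−s), p}, and set δ := min{q̄ − q, s − h}. Then ( ∫_{B_r} ⨍_{B_r} |w(x)−w(y)|^q |x−y|^{−n−hq} dx dy )^{1/q} ≤ c r^{−h} ( |μ|(B_r) / r^{n−sp} )^{1/(p−1)}, for a constant c depending only on n, s, p, Λ, δ (blowing up as δ → 0). -/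

import Mathlib

noncomputable section

open MeasureTheory Metric Set Filter Topology
open scoped ENNReal NNReal

/-- Euclidean space `ℝⁿ`. -/
abbrev Rn (n : ℕ) : Type := EuclideanSpace ℝ (Fin n)

/-- `q_* = max {1, p-1}`. -/
def qStar (p : ℝ) : ℝ := max 1 (p - 1)

/-- `q̄ = min {n(p-1)/(n-s), p}`. -/
def qBar (n : ℕ) (s p : ℝ) : ℝ := min ((n : ℝ) * (p - 1) / ((n : ℝ) - s)) p

/-- Gagliardo seminorm raised to the power `p`, as an `ℝ≥0∞`-valued double integral. -/
def gagliardo (n : ℕ) (s p : ℝ) (O : Set (Rn n)) (v : Rn n → ℝ) : ℝ≥0∞ :=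
  ∫⁻ x in O, ∫⁻ y in O, ENNReal.ofReal (|v x - v y| ^ p / ‖x - y‖ ^ ((n : ℝ) + s * p))

/-- `v ∈ W^{s,p}(O)`. -/
def memWsp (n : ℕ) (s p : ℝ) (O : Set (Rn n)) (v : Rn n → ℝ) : Prop :=
  AEMeasurable v (volume.restrict O) ∧
    (∫⁻ x in O, ENNReal.ofReal (|v x| ^ p)) < ⊤ ∧ gagliardo n s p O v < ⊤

/-- `Tail(v; x₀, r)`. -/
def tailFn (n : ℕ) (s p : ℝ) (v : Rn n → ℝ) (x₀ : Rn n) (r : ℝ) : ℝ≥0∞ :=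
  (ENNReal.ofReal (r ^ (s * p)) *
      ∫⁻ x in (ball x₀ r)ᶜ,
        ENNReal.ofReal (|v x| ^ (p - 1) / ‖x - x₀‖ ^ ((n : ℝ) + s * p))) ^ (1 / (p - 1))

/-- `v ∈ L^{p-1}_{sp}(ℝⁿ)`. -/
def memTailSpace (n : ℕ) (s p : ℝ) (v : Rn n → ℝ) : Prop :=
  AEMeasurable v (volume : Measure (Rn n)) ∧
    (∀ R : ℝ, (∫⁻ x in ball (0 : Rn n) R, ENNReal.ofReal (|v x| ^ (p - 1))) < ⊤) ∧
    ∀ z : Rn n, ∀ r : ℝ, 0 < r → tailFn n s p v z r < ⊤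

/-- `φ ∈ C_0^∞(O)`. -/
def IsTestFun (n : ℕ) (O : Set (Rn n)) (φ : Rn n → ℝ) : Prop :=
  ContDiff ℝ (⊤ : ℕ∞) φ ∧ HasCompactSupport φ ∧ tsupport φ ⊆ O

/-- The nonlocal form `⟨-L_Φ u, φ⟩`. -/
def nonlocalForm (n : ℕ) (Φ : ℝ → ℝ) (K : Rn n → Rn n → ℝ) (u φ : Rn n → ℝ) : ℝ :=
  ∫ x : Rn n, ∫ y : Rn n, Φ (u x - u y) * (φ x - φ y) * K x y

/-- Ellipticity/coercivity bounds on the kernel `K`. -/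
def KernelBounds (n : ℕ) (Λ s p : ℝ) (K : Rn n → Rn n → ℝ) : Prop :=
  Measurable (Function.uncurry K) ∧
    ∀ x y : Rn n, x ≠ y →
      1 / (Λ * ‖x - y‖ ^ ((n : ℝ) + s * p)) ≤ K x y ∧
        K x y ≤ Λ / ‖x - y‖ ^ ((n : ℝ) + s * p)

/-- Structure conditions on `Φ`. -/
def PhiBounds (Λ p : ℝ) (Φ : ℝ → ℝ) : Prop :=
  Continuous Φ ∧ Φ 0 = 0 ∧
    ∀ t : ℝ, |t| ^ p / Λ ≤ Φ t * t ∧ Φ t * t ≤ Λ * |t| ^ p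

/-- `∫ φ dμ` for a signed measure `μ`. -/
def sintegral (n : ℕ) (μ : MeasureTheory.SignedMeasure (Rn n)) (φ : Rn n → ℝ) : ℝ :=
  (∫ x, φ x ∂μ.toJordanDecomposition.posPart) -
    ∫ x, φ x ∂μ.toJordanDecomposition.negPart

/-- Weak (energy) solution of `-L_Φ u = f` in `Ω`, `u = g` on `ℝⁿ ∖ Ω`. -/
def WeakSol (n : ℕ) (Φ : ℝ → ℝ) (K : Rn n → Rn n → ℝ) (s p : ℝ)
    (Ω : Set (Rn n)) (f g u : Rn n → ℝ) : Prop :=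
  memWsp n s p univ u ∧ (∀ᵐ x : Rn n, x ∉ Ω → u x = g x) ∧
    ∀ φ : Rn n → ℝ, IsTestFun n Ω φ → nonlocalForm n Φ K u φ = ∫ x : Rn n, φ x * f x

/-- Weak subsolution of the homogeneous equation `-L_Φ w = 0` in `Ω`. -/
def WeakSubSol (n : ℕ) (Φ : ℝ → ℝ) (K : Rn n → Rn n → ℝ) (s p : ℝ)
    (Ω : Set (Rn n)) (w : Rn n → ℝ) : Prop :=
  memWsp n s p univ w ∧
    ∀ φ : Rn n → ℝ, IsTestFun n Ω φ → (∀ x, 0 ≤ φ x) → nonlocalForm n Φ K w φ ≤ 0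

/-- The approximation properties required of a SOLA. -/
def SOLAApprox (n : ℕ) (Φ : ℝ → ℝ) (K : Rn n → Rn n → ℝ) (s p : ℝ)
    (Ω : Set (Rn n)) (μ : MeasureTheory.SignedMeasure (Rn n)) (g u : Rn n → ℝ)
    (uj μj gj : ℕ → Rn n → ℝ) : Prop :=
  (∀ j, ContDiff ℝ (⊤ : ℕ∞) (μj j) ∧ HasCompactSupport (μj j)) ∧
  (∀ j, ContDiff ℝ (⊤ : ℕ∞) (gj j) ∧ HasCompactSupport (gj j)) ∧
  (∀ j, WeakSol n Φ K s p Ω (μj j) (gj j) (uj j)) ∧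
  (∀ᵐ x : Rn n, Tendsto (fun j => uj j x) atTop (𝓝 (u x))) ∧
  (∀ q : ℝ, qStar p ≤ q → q < qBar n s p → ∀ z : Rn n, ∀ r : ℝ, 0 < r →
    Tendsto (fun j => ∫⁻ x in ball z r, ENNReal.ofReal (|uj j x - u x| ^ q)) atTop (𝓝 0)) ∧
  (∀ φ : Rn n → ℝ, Continuous φ → HasCompactSupport φ → tsupport φ ⊆ Ω →
    Tendsto (fun j => ∫ x : Rn n, φ x * μj j x) atTop (𝓝 (sintegral n μ φ))) ∧
  (∀ z : Rn n, ∀ r : ℝ, 0 < r →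
    Filter.limsup (fun j => ∫⁻ x in ball z r, ENNReal.ofReal |μj j x|) atTop
      ≤ μ.totalVariation (closedBall z r)) ∧
  (∀ z : Rn n, ∀ r : ℝ, 0 < r →
    Tendsto (fun j =>
        (∫⁻ x in ball z r, ENNReal.ofReal (|gj j x - g x| ^ p)) +
          gagliardo n s p (ball z r) (fun x => gj j x - g x)) atTop (𝓝 0) ∧
      Tendsto (fun j => tailFn n s p (fun x => gj j x - g x) z r) atTop (𝓝 0))

/-- SOLA of the Dirichlet problem `-L_Φ u = μ` in `Ω`, `u = g` on `ℝⁿ ∖ Ω`. -/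
def IsSOLA (n : ℕ) (Φ : ℝ → ℝ) (K : Rn n → Rn n → ℝ) (s p : ℝ)
    (Ω : Set (Rn n)) (μ : MeasureTheory.SignedMeasure (Rn n)) (g u : Rn n → ℝ) : Prop :=
  (∀ h q : ℝ, 0 < h → h < s → qStar p ≤ q → q < qBar n s p → memWsp n h q Ω u) ∧
  (∀ φ : Rn n → ℝ, IsTestFun n Ω φ → nonlocalForm n Φ K u φ = sintegral n μ φ) ∧
  (∀ᵐ x : Rn n, x ∉ Ω → u x = g x) ∧
  ∃ uj μj gj : ℕ → Rn n → ℝ, SOLAApprox n Φ K s p Ω μ g u uj μj gj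

/-- Truncated Wolff potential `W^ν_{s,p}(x₀, r)`. -/
def wolff (n : ℕ) (s p : ℝ) (ν : Measure (Rn n)) (x₀ : Rn n) (r : ℝ) : ℝ≥0∞ :=
  ∫⁻ ρ in Ioc (0 : ℝ) r,
    (ν (ball x₀ ρ) / ENNReal.ofReal (ρ ^ ((n : ℝ) - s * p))) ^ (1 / (p - 1)) /
      ENNReal.ofReal ρ

/-- Integral average of `u` over `B_r(x₀)`. -/
def ballAvg (n : ℕ) (u : Rn n → ℝ) (x₀ : Rn n) (r : ℝ) : ℝ :=
  ⨍ x in ball x₀ r, u x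

/-- Local excess `A(f; x₀, r)`. -/
def locExcess (n : ℕ) (p : ℝ) (f : Rn n → ℝ) (x₀ : Rn n) (r : ℝ) : ℝ≥0∞ :=
  ((volume (ball x₀ r))⁻¹ *
      ∫⁻ x in ball x₀ r, ENNReal.ofReal (|f x - ballAvg n f x₀ r| ^ qStar p)) ^ (1 / qStar p)

/-- Global excess `E(f; x₀, r)`. -/
def excess (n : ℕ) (s p : ℝ) (f : Rn n → ℝ) (x₀ : Rn n) (r : ℝ) : ℝ≥0∞ :=
  locExcess n p f x₀ r + tailFn n s p (fun x => f x - ballAvg n f x₀ r) x₀ r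

/-- `g ∈ W^{s,p}_loc(ℝⁿ) ∩ L^{p-1}_{sp}(ℝⁿ)`. -/
def BoundaryDatum (n : ℕ) (s p : ℝ) (g : Rn n → ℝ) : Prop :=
  (∀ z : Rn n, ∀ r : ℝ, 0 < r → memWsp n s p (ball z r) g) ∧ memTailSpace n s p g

/-- Symmetric measurable kernel with ellipticity bounds. -/
def SymKernel (n : ℕ) (Λ s p : ℝ) (Kt : Rn n → Rn n → ℝ) : Prop :=
  KernelBounds n Λ s p Kt ∧ ∀ x y : Rn n, Kt x y = Kt y x

/-- Weak solution of the kernel-`Kt` fractional `p`-Laplace equation with datum `f` in `O`. -/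
def WeakSolP (n : ℕ) (Kt : Rn n → Rn n → ℝ) (s p : ℝ) (O : Set (Rn n))
    (f u : Rn n → ℝ) : Prop :=
  memWsp n s p univ u ∧
    ∀ φ : Rn n → ℝ, IsTestFun n O φ →
      (∫ x : Rn n, ∫ y : Rn n,
          |u x - u y| ^ (p - 2) * (u x - u y) * (φ x - φ y) * Kt x y) =
        ∫ x : Rn n, φ x * f x

/-- Strong monotonicity of `t ↦ |t|^{p-2} t` for ordered arguments. -/
lemma rpow_le_signedPow_sub {p : ℝ} (hp : 2 ≤ p) {a b : ℝ} (hab : b ≤ a) :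
    2 ^ (1 - p) * (a - b) ^ (p - 1) ≤ |a| ^ (p - 2) * a - |b| ^ (p - 2) * b := by
  have hpow : ∀ t : ℝ, 0 ≤ t → t ^ (p - 2) * t = t ^ (p - 1) := by
    intro t ht
    rcases ht.eq_or_lt with rfl | ht
    · rw [Real.zero_rpow (by linarith : p - 1 ≠ 0), mul_zero]
    · rw [← Real.rpow_add_one ht.ne']; congr 1; ring
  have h2 : (2 : ℝ) ^ (1 - p) ≤ 1 := Real.rpow_le_one_of_one_le_of_nonpos (by norm_num) (by linarith)
  have key : ∀ x y : ℝ, 0 ≤ y → y ≤ x →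
      2 ^ (1 - p) * (x - y) ^ (p - 1) ≤ x ^ (p - 1) - y ^ (p - 1) := by
    intro x y hy hxy
    have h := Real.add_rpow_le_rpow_add (sub_nonneg.2 hxy) hy (by linarith : 1 ≤ p - 1)
    rw [sub_add_cancel] at h
    have h0 : 0 ≤ (x - y) ^ (p - 1) := Real.rpow_nonneg (sub_nonneg.2 hxy) _
    nlinarith
  rcases le_total 0 b with hb | hb
  · rw [abs_of_nonneg hb, abs_of_nonneg (hb.trans hab), hpow _ hb, hpow _ (hb.trans hab)]
    exact key a b hb hab
  rcases le_total 0 a with ha | ha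
  · rw [abs_of_nonneg ha, abs_of_nonpos hb, hpow _ ha]
    have e : (-b) ^ (p - 2) * b = -((-b) ^ (p - 1)) := by
      rw [← hpow (-b) (by linarith)]; ring
    rw [e, sub_neg_eq_add]
    have hm : (a - b) / 2 ≤ max a (-b) := by
      rcases le_total a (-b) with h | h
      · rw [max_eq_right h]; linarith
      · rw [max_eq_left h]; linarith
    have h1 : ((a - b) / 2) ^ (p - 1) ≤ (max a (-b)) ^ (p - 1) :=
      Real.rpow_le_rpow (by linarith) hm (by linarith)
    have e2 : ((a - b) / 2) ^ (p - 1) = 2 ^ (1 - p) * (a - b) ^ (p - 1) := by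
      rw [Real.div_rpow (by linarith) (by norm_num), div_eq_inv_mul, ← Real.rpow_neg (by norm_num)]
      congr 2; ring
    rw [← e2]
    refine h1.trans ?_
    have n1 : 0 ≤ a ^ (p - 1) := Real.rpow_nonneg ha _
    have n2 : 0 ≤ (-b) ^ (p - 1) := Real.rpow_nonneg (by linarith) _
    rcases max_choice a (-b) with h | h <;> rw [h] <;> linarith
  · rw [abs_of_nonpos ha, abs_of_nonpos hb]
    have := key (-b) (-a) (by linarith) (by linarith)
    rw [← hpow (-b) (by linarith), ← hpow (-a) (by linarith)] at this
    calc _ = 2 ^ (1 - p) * (-b - -a) ^ (p - 1) := by congr 2; ring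
      _ ≤ _ := this
      _ = _ := by ring

/-- Strong monotonicity of `t ↦ |t|^{p-2} t`. -/
lemma abs_rpow_le_signedPow_sub_mul {p : ℝ} (hp : 2 ≤ p) (a b : ℝ) :
    2 ^ (1 - p) * |a - b| ^ p ≤ (|a| ^ (p - 2) * a - |b| ^ (p - 2) * b) * (a - b) := by
  have hpow : ∀ t : ℝ, 0 ≤ t → t ^ p = t ^ (p - 1) * t := by
    intro t ht
    rcases ht.eq_or_lt with rfl | ht
    · rw [Real.zero_rpow (by linarith : p ≠ 0), mul_zero]
    · rw [← Real.rpow_add_one ht.ne']; congr 1; ring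
  rcases le_total b a with h | h
  · have := rpow_le_signedPow_sub hp h
    rw [abs_of_nonneg (sub_nonneg.2 h), hpow _ (sub_nonneg.2 h), ← mul_assoc]
    exact mul_le_mul_of_nonneg_right this (sub_nonneg.2 h)
  · have := rpow_le_signedPow_sub hp h
    rw [abs_sub_comm, abs_of_nonneg (sub_nonneg.2 h), hpow _ (sub_nonneg.2 h), ← mul_assoc]
    calc _ ≤ (|b| ^ (p - 2) * b - |a| ^ (p - 2) * a) * (b - a) :=
          mul_le_mul_of_nonneg_right this (sub_nonneg.2 h)
      _ = _ := by ring

/-- A bounded increasing Lipschitz function with slope between `(d + |a| + |b|)^{-ξ}` and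
`d^{-ξ}`. -/
lemma exists_bounded_slope {d ξ : ℝ} (hd : 0 < d) (hξ : 1 < ξ) :
    ∃ G : ℝ → ℝ, G 0 = 0 ∧ (∀ t, |G t| ≤ d ^ (1 - ξ) / (ξ - 1)) ∧ Continuous G ∧
      ∀ a b, ∃ m, G a - G b = m * (a - b) ∧ (d + |a| + |b|) ^ (-ξ) ≤ m ∧ m ≤ d ^ (-ξ) := by
  set g : ℝ → ℝ := fun t => (d + |t|) ^ (-ξ) with hg
  have hpos : ∀ t : ℝ, 0 < d + |t| := fun t => by positivity
  have hgc : Continuous g :=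
    (continuous_const.add continuous_abs).rpow_const fun t => Or.inl (hpos t).ne'
  have hderiv : ∀ t, HasDerivAt (fun t => ∫ τ in (0 : ℝ)..t, g τ) (g t) t := fun t =>
    intervalIntegral.integral_hasDerivAt_right (hgc.intervalIntegrable _ _)
      hgc.aestronglyMeasurable.stronglyMeasurableAtFilter hgc.continuousAt
  have hgle : ∀ t, g t ≤ d ^ (-ξ) := fun t =>
    Real.rpow_le_rpow_of_nonpos hd (by linarith [abs_nonneg t]) (by linarith)
  have hcont : Continuous (fun t => ∫ τ in (0 : ℝ)..t, g τ) :=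
    continuous_iff_continuousAt.2 fun t => (hderiv t).continuousAt
  have hbound : ∀ t : ℝ, 0 ≤ t → |∫ τ in (0 : ℝ)..t, g τ| ≤ d ^ (1 - ξ) / (ξ - 1) := by
    intro t ht
    have e : ∫ τ in (0 : ℝ)..t, g τ = ∫ τ in (0 : ℝ)..t, (fun x : ℝ => x ^ (-ξ)) (d + τ) := by
      refine intervalIntegral.integral_congr fun τ hτ => ?_
      rw [uIcc_of_le ht] at hτ
      simp only [hg, abs_of_nonneg hτ.1]
    rw [abs_of_nonneg (intervalIntegral.integral_nonneg ht fun τ _ => Real.rpow_nonneg (hpos τ).le _),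
      e, intervalIntegral.integral_comp_add_left (fun x : ℝ => x ^ (-ξ)) d,
      integral_rpow (Or.inr ⟨by linarith, by
        rw [uIcc_of_le (by linarith)]; intro h; linarith [h.1]⟩)]
    have e1 : -ξ + 1 = 1 - ξ := by ring
    have h3 : 0 ≤ (d + t) ^ (1 - ξ) := Real.rpow_nonneg (by linarith) _
    rw [e1, add_zero, ← neg_div_neg_eq]
    rw [div_le_div_iff₀ (by linarith) (by linarith)]
    nlinarith
  have hodd : ∀ t : ℝ, ∫ τ in (0 : ℝ)..(-t), g τ = -∫ τ in (0 : ℝ)..t, g τ := by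
    intro t
    have h := intervalIntegral.integral_comp_neg (a := 0) (b := t) g
    have h2 : ∫ x in (0:ℝ)..t, g (-x) = ∫ x in (0:ℝ)..t, g x := by simp [hg]
    rw [← h2, h, neg_zero, intervalIntegral.integral_symm]
  have main : ∀ a b : ℝ, a < b → ∃ m, (∫ τ in (0 : ℝ)..a, g τ) - (∫ τ in (0 : ℝ)..b, g τ)
      = m * (a - b) ∧ (d + |a| + |b|) ^ (-ξ) ≤ m ∧ m ≤ d ^ (-ξ) := by
    intro a b hab
    obtain ⟨c, hc, hcs⟩ := exists_hasDerivAt_eq_slope _ g hab hcont.continuousOn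
      (fun x _ => hderiv x)
    refine ⟨g c, ?_, ?_, hgle c⟩
    · rw [hcs, div_mul_eq_mul_div, eq_div_iff (by linarith)]; ring
    · refine Real.rpow_le_rpow_of_nonpos (hpos c) ?_ (by linarith)
      have : |c| ≤ |a| + |b| := abs_le.2 ⟨by linarith [neg_abs_le a, abs_nonneg b, hc.1],
        by linarith [le_abs_self b, abs_nonneg a, hc.2]⟩
      linarith
  refine ⟨fun t => ∫ τ in (0 : ℝ)..t, g τ, by simp, fun t => ?_, hcont, fun a b => ?_⟩
  · rcases le_total 0 t with ht | ht
    · exact hbound t ht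
    · have := hbound (-t) (by linarith)
      rwa [hodd, abs_neg] at this
  · rcases lt_trichotomy a b with h | h | h
    · exact main a b h
    · refine ⟨d ^ (-ξ), by simp [h], ?_, le_rfl⟩
      exact Real.rpow_le_rpow_of_nonpos hd (by linarith [abs_nonneg a, abs_nonneg b]) (by linarith)
    · obtain ⟨m, h1, h2, h3⟩ := main b a h
      refine ⟨m, by linarith, ?_, h3⟩
      rwa [add_right_comm]

lemma volume_ball_rn {n : ℕ} (x : Rn n) {ρ : ℝ} (hρ : 0 < ρ) :
    volume (ball x ρ) = ENNReal.ofReal (ρ ^ (n : ℝ) * volume.real (ball (0 : Rn n) 1)) := by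
  rw [Measure.addHaar_ball_of_pos _ _ hρ, finrank_euclideanSpace_fin,
    ENNReal.ofReal_mul (by positivity), measureReal_def,
    ENNReal.ofReal_toReal measure_ball_lt_top.ne, Real.rpow_natCast]

/-- The singular kernel has mass at least a multiple of `|A|^{-β/n}` outside of `A`. -/
lemma exists_le_lintegral_compl_kernel {n : ℕ} (hn : 2 ≤ n) {β : ℝ} (hβ : 0 < β) :
    ∃ c : ℝ, 0 < c ∧ ∀ A : Set (Rn n), MeasurableSet A → 0 < volume.real A → ∀ x : Rn n,
      ENNReal.ofReal (c * volume.real A ^ (-(β / n))) ≤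
        ∫⁻ y in Aᶜ, ENNReal.ofReal (1 / ‖x - y‖ ^ ((n : ℝ) + β)) := by
  have : Nonempty (Fin n) := ⟨⟨0, by omega⟩⟩
  have hn0 : (0 : ℝ) < n := by exact_mod_cast (by omega : 0 < n)
  set ω := volume.real (ball (0 : Rn n) 1) with hω
  have hω0 : 0 < ω := ENNReal.toReal_pos (measure_ball_pos _ _ one_pos).ne' measure_ball_lt_top.ne
  refine ⟨(2 / ω) ^ (-(((n : ℝ) + β) / n)), by positivity, fun A hA ha x => ?_⟩
  set a := volume.real A with ha'
  have hAfin : volume A ≠ ⊤ := fun h => by simp [ha', measureReal_def, h] at ha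
  set ρ : ℝ := (2 * a / ω) ^ (1 / (n : ℝ)) with hρ
  have hb0 : 0 < 2 * a / ω := by positivity
  have hρ0 : 0 < ρ := Real.rpow_pos_of_pos hb0 _
  have hρn : ρ ^ (n : ℝ) = 2 * a / ω := by
    rw [hρ, ← Real.rpow_mul hb0.le, one_div_mul_cancel hn0.ne', Real.rpow_one]
  set S := (ball x ρ \ A) \ {x} with hS
  have hSm : MeasurableSet S := (measurableSet_ball.diff hA).diff (measurableSet_singleton x)
  have hSvol : ENNReal.ofReal a ≤ volume S := by
    have h1 : volume S = volume (ball x ρ \ A) := by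
      rw [hS, measure_sdiff_null (measure_singleton x)]
    rw [h1]
    refine le_trans ?_ le_measure_sdiff
    rw [volume_ball_rn x hρ0, hρn, div_mul_cancel₀ _ hω0.ne', ← ENNReal.ofReal_toReal hAfin,
      ← measureReal_def, ← ENNReal.ofReal_sub _ ha.le]
    exact ENNReal.ofReal_le_ofReal (by linarith)
  calc ENNReal.ofReal ((2 / ω) ^ (-(((n : ℝ) + β) / n)) * a ^ (-(β / n)))
      = ENNReal.ofReal (1 / ρ ^ ((n : ℝ) + β)) * ENNReal.ofReal a := by
        rw [← ENNReal.ofReal_mul (by positivity)]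
        congr 1
        have e1 : ρ ^ ((n : ℝ) + β) = (2 / ω) ^ (((n : ℝ) + β) / n) * a ^ (((n : ℝ) + β) / n) := by
          rw [hρ, ← Real.rpow_mul hb0.le, ← Real.mul_rpow (by positivity) ha.le]
          congr 1 <;> field_simp
        have e2 : a ^ (-(β / n)) = a ^ (-(((n : ℝ) + β) / n)) * a := by
          rw [← Real.rpow_add_one ha.ne']; congr 1; field_simp; ring
        rw [e1, e2, Real.rpow_neg (by positivity), Real.rpow_neg ha.le]
        field_simp
    _ ≤ ENNReal.ofReal (1 / ρ ^ ((n : ℝ) + β)) * volume S := by gcongr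
    _ = ∫⁻ y in S, ENNReal.ofReal (1 / ρ ^ ((n : ℝ) + β)) := by rw [setLIntegral_const]
    _ ≤ ∫⁻ y in S, ENNReal.ofReal (1 / ‖x - y‖ ^ ((n : ℝ) + β)) := by
        refine setLIntegral_mono' hSm fun y hy => ENNReal.ofReal_le_ofReal ?_
        have hy1 : 0 < ‖x - y‖ := norm_pos_iff.2 (sub_ne_zero.2 fun h => hy.2 (by simp [h]))
        have hy2 : ‖x - y‖ ≤ ρ := by
          have := mem_ball.1 hy.1.1
          rw [dist_comm, dist_eq_norm] at this
          exact this.le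
        gcongr
    _ ≤ ∫⁻ y in Aᶜ, ENNReal.ofReal (1 / ‖x - y‖ ^ ((n : ℝ) + β)) :=
        lintegral_mono_set fun y hy => hy.1.2

/-- Decay of the super-level sets encoded by the logarithmic-type energy bound. -/
lemma exists_measure_superlevel_le {n : ℕ} (hn : 2 ≤ n) {β p ξ C₁ : ℝ} (hβ : 0 < β)
    (hξ : 1 < ξ) (hξp : ξ ≤ p) :
    ∃ C : ℝ, 0 < C ∧ ∀ w : Rn n → ℝ, Measurable w → (∀ x, x ∉ ball (0 : Rn n) 1 → w x = 0) →
      (∀ k : ℝ, 0 < k → (∫⁻ x, ∫⁻ y, ENNReal.ofReal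
        (|w x - w y| ^ p / (k + |w x| + |w y|) ^ ξ / ‖x - y‖ ^ ((n : ℝ) + β))) ≤
          ENNReal.ofReal (C₁ * k ^ (1 - ξ))) →
      ∀ k : ℝ, 0 < k → volume.real {x | 2 * k ≤ |w x|} ≤
        C * k ^ (1 - p) * volume.real {x | k ≤ |w x|} ^ (β / n) := by
  obtain ⟨c, hc, hker⟩ := exists_le_lintegral_compl_kernel hn hβ
  refine ⟨4 ^ ξ / c * max C₁ 1, by positivity, fun w hw hw0 hE k hk => ?_⟩
  have hsub : ∀ t : ℝ, 0 < t → {x | t ≤ |w x|} ⊆ ball (0 : Rn n) 1 := by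
    intro t ht x hx
    by_contra h
    simp only [mem_ofPred_eq, hw0 x h, abs_zero] at hx
    linarith
  set A := {x | k ≤ |w x|} with hA
  set A2 := {x | 2 * k ≤ |w x|} with hA2
  have hAm : MeasurableSet A := measurableSet_le measurable_const hw.abs
  have hA2m : MeasurableSet A2 := measurableSet_le measurable_const hw.abs
  have hfin : ∀ t : ℝ, 0 < t → volume {x | t ≤ |w x|} ≠ ⊤ := fun t ht =>
    ne_top_of_le_ne_top measure_ball_lt_top.ne (measure_mono (hsub t ht))
  have hA2A : A2 ⊆ A := fun x (hx : 2 * k ≤ |w x|) => show k ≤ |w x| by linarith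
  rcases (measureReal_nonneg : 0 ≤ volume.real A).eq_or_lt with h0 | hpos
  · have : volume.real A2 ≤ volume.real A := measureReal_mono hA2A (hfin k hk)
    rw [← h0] at this
    refine this.trans ?_
    positivity
  set a := volume.real A with ha
  set a2 := volume.real A2 with ha2
  have hpt : ∀ x ∈ A2, ∀ y ∈ Aᶜ, (4 : ℝ) ^ (-ξ) * k ^ (p - ξ) * (1 / ‖x - y‖ ^ ((n : ℝ) + β)) ≤
      |w x - w y| ^ p / (k + |w x| + |w y|) ^ ξ / ‖x - y‖ ^ ((n : ℝ) + β) := by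
    intro x hx y hy
    have hx' : 2 * k ≤ |w x| := hx
    have hy' : |w y| < k := not_le.1 hy
    have hD : |w x| - |w y| ≤ |w x - w y| := abs_sub_abs_le_abs_sub _ _
    set D := |w x - w y| with hDdef
    set N := k + |w x| + |w y| with hN
    have hDpos : 0 < D := by linarith
    have hN0 : 0 < N := by have := abs_nonneg (w y); linarith
    have h1 : N / 4 ≤ D := by linarith
    have h2 : k ≤ D := by linarith
    rw [mul_one_div]
    gcongr
    have e : D ^ p = D ^ ξ * D ^ (p - ξ) := by
      rw [← Real.rpow_add hDpos]; congr 1; ring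
    rw [le_div_iff₀ (by positivity), e]
    calc (4 : ℝ) ^ (-ξ) * k ^ (p - ξ) * N ^ ξ = (N / 4) ^ ξ * k ^ (p - ξ) := by
          rw [Real.div_rpow hN0.le (by norm_num), Real.rpow_neg (by norm_num)]; ring
      _ ≤ _ := by
          have := sub_nonneg.2 hξp
          gcongr
  have hmain : ENNReal.ofReal (4 ^ (-ξ) * k ^ (p - ξ) * (c * a ^ (-(β / n))) * a2) ≤
      ENNReal.ofReal (C₁ * k ^ (1 - ξ)) := by
    refine le_trans ?_ (hE k hk)
    calc ENNReal.ofReal (4 ^ (-ξ) * k ^ (p - ξ) * (c * a ^ (-(β / n))) * a2)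
        = ∫⁻ x in A2, ENNReal.ofReal (4 ^ (-ξ) * k ^ (p - ξ)) *
            ENNReal.ofReal (c * a ^ (-(β / n))) := by
          rw [setLIntegral_const, ENNReal.ofReal_mul (by positivity),
            ENNReal.ofReal_mul (by positivity), ha2, measureReal_def,
            ENNReal.ofReal_toReal (hfin _ (by linarith))]
      _ ≤ ∫⁻ x in A2, ∫⁻ y in Aᶜ, ENNReal.ofReal
            (|w x - w y| ^ p / (k + |w x| + |w y|) ^ ξ / ‖x - y‖ ^ ((n : ℝ) + β)) := by
          refine setLIntegral_mono' hA2m fun x hx => ?_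
          refine (mul_le_mul_right (hker A hAm hpos x) _).trans ?_
          rw [← lintegral_const_mul' _ _ ENNReal.ofReal_ne_top]
          refine setLIntegral_mono' hAm.compl fun y hy => ?_
          rw [← ENNReal.ofReal_mul (by positivity)]
          exact ENNReal.ofReal_le_ofReal (hpt x hx y hy)
      _ ≤ _ := (setLIntegral_le_lintegral _ _).trans
          (lintegral_mono fun x => setLIntegral_le_lintegral _ _)
  have hmain2 : 4 ^ (-ξ) * k ^ (p - ξ) * (c * a ^ (-(β / n))) * a2 ≤
      max C₁ 1 * k ^ (1 - ξ) := by
    refine (ENNReal.ofReal_le_ofReal_iff (by positivity)).1 (hmain.trans ?_)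
    exact ENNReal.ofReal_le_ofReal (by gcongr; exact le_max_left _ _)
  have e1 : k ^ (1 - ξ) = k ^ (p - ξ) * k ^ (1 - p) := by
    rw [← Real.rpow_add hk]; congr 1; ring
  rw [e1, Real.rpow_neg (by norm_num), Real.rpow_neg hpos.le] at hmain2
  have hk1 : 0 < k ^ (p - ξ) := Real.rpow_pos_of_pos hk _
  have h4 : (0 : ℝ) < 4 ^ ξ := by positivity
  have haa : 0 < a ^ (β / n) := by positivity
  have : k ^ (p - ξ) * (c * a2 / (4 ^ ξ * a ^ (β / n))) ≤
      k ^ (p - ξ) * (max C₁ 1 * k ^ (1 - p)) := by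
    calc _ = (4 ^ ξ)⁻¹ * k ^ (p - ξ) * (c * (a ^ (β / n))⁻¹) * a2 := by field_simp
      _ ≤ _ := hmain2
      _ = _ := by ring
  have := le_of_mul_le_mul_left this hk1
  rw [div_le_iff₀ (by positivity)] at this
  calc a2 = c * a2 / c := by field_simp
    _ ≤ max C₁ 1 * k ^ (1 - p) * (4 ^ ξ * a ^ (β / n)) / c := by gcongr
    _ = _ := by ring

/-- Geometric decay obtained by iterating a nonlinear recursion. -/
lemma le_geometric_of_recursion {a : ℕ → ℝ} {θ C' P : ℝ} (hθ0 : 0 ≤ θ) (hθ1 : θ < 1)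
    (hC' : 0 < C') (ha : ∀ j, 0 ≤ a j) (ha0 : a 0 ≤ 1)
    (hrec : ∀ j : ℕ, a (j + 1) ≤ C' * ((2 : ℝ) ^ (j : ℝ)) ^ (-P) * a j ^ θ) (j : ℕ) :
    a j ≤ max 1 (C' * 2 ^ (P / (1 - θ))) ^ (1 / (1 - θ)) * ((2 : ℝ) ^ (-(P / (1 - θ)))) ^ j := by
  set m := P / (1 - θ) with hm
  have hθc : 0 < 1 - θ := by linarith
  have hmP : m * (1 - θ) = P := div_mul_cancel₀ _ hθc.ne'
  set L := max 1 (C' * 2 ^ m) with hL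
  have hL1 : 1 ≤ L := le_max_left _ _
  have hL0 : 0 < L := by linarith
  set K := L ^ (1 / (1 - θ)) with hK
  have hK0 : 0 < K := Real.rpow_pos_of_pos hL0 _
  have hKL : L * K ^ θ = K := by
    have : K = K ^ (1 - θ) * K ^ θ := by
      rw [← Real.rpow_add hK0, sub_add_cancel, Real.rpow_one]
    conv_rhs => rw [this]
    rw [hK, ← Real.rpow_mul hL0.le (1 / (1 - θ)) (1 - θ), one_div_mul_cancel hθc.ne', Real.rpow_one]
  have hK1 : 1 ≤ K := Real.one_le_rpow hL1 (by positivity)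
  clear_value K
  induction j with
  | zero =>
    rw [pow_zero, mul_one]
    exact ha0.trans hK1
  | succ j ih =>
    have hx : ∀ i : ℕ, ((2 : ℝ) ^ (-m)) ^ i = 2 ^ (-m * i) := fun i => by
      rw [← Real.rpow_natCast, ← Real.rpow_mul (by norm_num)]
    rw [hx] at ih ⊢
    calc a (j + 1) ≤ C' * ((2 : ℝ) ^ (j : ℝ)) ^ (-P) * a j ^ θ := hrec j
      _ ≤ C' * ((2 : ℝ) ^ (j : ℝ)) ^ (-P) * (K * 2 ^ (-m * j)) ^ θ := by
          have := ha j
          gcongr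
      _ = (C' * 2 ^ m) * K ^ θ * 2 ^ (-m * ((j + 1 : ℕ) : ℝ)) := by
          rw [Real.mul_rpow hK0.le (by positivity), ← Real.rpow_mul (by norm_num),
            ← Real.rpow_mul (by norm_num)]
          have : (2 : ℝ) ^ ((j : ℝ) * -P) * 2 ^ (-m * j * θ) = 2 ^ m * 2 ^ (-m * ((j + 1 : ℕ) : ℝ)) := by
            rw [← Real.rpow_add (by norm_num), ← Real.rpow_add (by norm_num)]
            congr 1
            push_cast
            rw [← hmP]; ring
          linear_combination (C' * K ^ θ) * this
      _ ≤ L * K ^ θ * 2 ^ (-m * ((j + 1 : ℕ) : ℝ)) := by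
          gcongr
          exact le_max_right _ _
      _ = _ := by rw [hKL]

/-- Pointwise dyadic layer decomposition. -/
lemma ofReal_rpow_le_tsum_indicator {γ t : ℝ} (hγ : 0 < γ) (ht : 0 ≤ t) :
    ENNReal.ofReal ((1 + 2 * t) ^ γ) ≤ ENNReal.ofReal (3 ^ γ) +
      ∑' j : ℕ, ENNReal.ofReal ((6 : ℝ) ^ γ * ((2 : ℝ) ^ γ) ^ j) *
        (if (2 : ℝ) ^ j ≤ t then 1 else 0) := by
  rcases lt_or_ge t 1 with h | h
  · refine le_add_of_le_of_nonneg (ENNReal.ofReal_le_ofReal ?_) zero_le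
    exact Real.rpow_le_rpow (by linarith) (by linarith) hγ.le
  · obtain ⟨j, hj1, hj2⟩ := exists_nat_pow_near h (by norm_num : (1 : ℝ) < 2)
    refine le_add_of_nonneg_of_le zero_le (le_trans ?_ (ENNReal.le_tsum j))
    rw [if_pos hj1, mul_one]
    refine ENNReal.ofReal_le_ofReal ?_
    have : ((2 : ℝ) ^ γ) ^ j = ((2 : ℝ) ^ j) ^ γ := by
      rw [← Real.rpow_natCast, ← Real.rpow_natCast, ← Real.rpow_mul (by norm_num),
        ← Real.rpow_mul (by norm_num), mul_comm]
    rw [this, ← Real.mul_rpow (by norm_num) (by positivity)]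
    refine Real.rpow_le_rpow (by linarith) ?_ hγ.le
    rw [pow_succ] at hj2
    linarith

/-- Marcinkiewicz-type integrability of functions satisfying the logarithmic energy bound. -/
lemma exists_lintegral_rpow_le {n : ℕ} (hn : 2 ≤ n) {β p ξ C₁ θ γ : ℝ} (hβ : 0 < β)
    (hξ : 1 < ξ) (hξp : ξ ≤ p) (hθ0 : 0 ≤ θ) (hθ1 : θ < 1) (hθβ : θ ≤ β / n)
    (hγ0 : 0 < γ) (hγ : γ < (p - 1) / (1 - θ)) :
    ∃ C : ℝ≥0∞, C ≠ ⊤ ∧ ∀ w : Rn n → ℝ, Measurable w → (∀ x, x ∉ ball (0 : Rn n) 1 → w x = 0) →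
      (∀ k : ℝ, 0 < k → (∫⁻ x, ∫⁻ y, ENNReal.ofReal
        (|w x - w y| ^ p / (k + |w x| + |w y|) ^ ξ / ‖x - y‖ ^ ((n : ℝ) + β))) ≤
          ENNReal.ofReal (C₁ * k ^ (1 - ξ))) →
      ∫⁻ x in ball (0 : Rn n) 1, ENNReal.ofReal ((1 + 2 * |w x|) ^ γ) ≤ C := by
  have : Nonempty (Fin n) := ⟨⟨0, by omega⟩⟩
  obtain ⟨C, hC, hrec⟩ := exists_measure_superlevel_le (C₁ := C₁) hn hβ hξ hξp
  set ω := volume.real (ball (0 : Rn n) 1) with hω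
  have hω0 : 0 < ω := ENNReal.toReal_pos (measure_ball_pos _ _ one_pos).ne' measure_ball_lt_top.ne
  set P := p - 1 with hP
  set C' := C * ω ^ (β / n) / ω with hC'
  have hC'0 : 0 < C' := by positivity
  set m := P / (1 - θ) with hm
  set K := max 1 (C' * 2 ^ m) ^ (1 / (1 - θ)) with hK
  have hK0 : 0 < K := Real.rpow_pos_of_pos (lt_of_lt_of_le one_pos (le_max_left _ _)) _
  set b := (2 : ℝ) ^ γ * 2 ^ (-m) with hb
  have hb0 : 0 ≤ b := by positivity
  have hb1 : b < 1 := by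
    rw [hb, ← Real.rpow_add (by norm_num)]
    exact Real.rpow_lt_one_of_one_lt_of_neg (by norm_num) (by linarith)
  refine ⟨ENNReal.ofReal (3 ^ γ * ω) + ENNReal.ofReal (∑' j : ℕ, 6 ^ γ * K * ω * b ^ j),
    by simp, fun w hw hw0 hE => ?_⟩
  have hrec := hrec w hw hw0 hE
  have hsub : ∀ t : ℝ, 0 < t → {x | t ≤ |w x|} ⊆ ball (0 : Rn n) 1 := by
    intro t ht x hx
    by_contra h
    simp only [mem_ofPred_eq, hw0 x h, abs_zero] at hx
    linarith
  have hdecay := le_geometric_of_recursion (a := fun j => volume.real {x | (2 : ℝ) ^ j ≤ |w x|} / ω)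
    (C' := C') (P := P) hθ0 hθ1 hC'0 (fun j => by positivity)
    (by
      rw [div_le_one hω0]
      exact measureReal_mono (hsub _ (by positivity)) measure_ball_lt_top.ne)
    (by
      intro j
      set aj := volume.real {x | (2 : ℝ) ^ j ≤ |w x|} with haj
      have h1 := hrec ((2 : ℝ) ^ j) (by positivity)
      rw [← pow_succ'] at h1
      have haω : aj / ω ≤ 1 := by
        rw [div_le_one hω0]
        exact measureReal_mono (hsub _ (by positivity)) measure_ball_lt_top.ne
      have h0 : 0 ≤ aj := measureReal_nonneg
      have h2 : aj ^ (β / n) ≤ ω ^ (β / n) * (aj / ω) ^ θ := by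
        calc aj ^ (β / n) = ω ^ (β / n) * (aj / ω) ^ (β / n) := by
              rw [← Real.mul_rpow hω0.le (by positivity), mul_div_cancel₀ _ hω0.ne']
          _ ≤ _ := by
              gcongr ?_ * ?_
              exact Real.rpow_le_rpow_of_exponent_ge' (by positivity) haω hθ0 hθβ
      rw [div_le_iff₀ hω0, Real.rpow_natCast]
      calc _ ≤ C * ((2 : ℝ) ^ j) ^ (1 - p) * aj ^ (β / n) := h1
        _ ≤ C * ((2 : ℝ) ^ j) ^ (1 - p) * (ω ^ (β / n) * (aj / ω) ^ θ) := by gcongr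
        _ = _ := by
            rw [hC', show 1 - p = -P by rw [hP]; ring]
            field_simp)
  have hmeas : ∀ j : ℕ, MeasurableSet {x | (2 : ℝ) ^ j ≤ |w x|} := fun j =>
    measurableSet_le measurable_const hw.abs
  have hvol : ∀ j : ℕ, volume {x | (2 : ℝ) ^ j ≤ |w x|} ≤
      ENNReal.ofReal (K * (2 ^ (-m)) ^ j * ω) := by
    intro j
    have h1 := (div_le_iff₀ hω0).1 (hdecay j)
    rw [← ENNReal.ofReal_toReal (ne_top_of_le_ne_top measure_ball_lt_top.ne
      (measure_mono (hsub _ (by positivity))))]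
    exact ENNReal.ofReal_le_ofReal h1
  calc ∫⁻ x in ball (0 : Rn n) 1, ENNReal.ofReal ((1 + 2 * |w x|) ^ γ)
      ≤ ∫⁻ x in ball (0 : Rn n) 1, (ENNReal.ofReal (3 ^ γ) +
          ∑' j : ℕ, ENNReal.ofReal ((6 : ℝ) ^ γ * ((2 : ℝ) ^ γ) ^ j) *
            {x | (2 : ℝ) ^ j ≤ |w x|}.indicator 1 x) := by
        refine lintegral_mono fun x => ?_
        simpa [indicator_apply] using ofReal_rpow_le_tsum_indicator hγ0 (abs_nonneg (w x))
    _ = ENNReal.ofReal (3 ^ γ * ω) + ∑' j : ℕ, ENNReal.ofReal ((6 : ℝ) ^ γ * ((2 : ℝ) ^ γ) ^ j) *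
            ∫⁻ x in ball (0 : Rn n) 1, {x | (2 : ℝ) ^ j ≤ |w x|}.indicator 1 x := by
        rw [lintegral_add_left measurable_const, setLIntegral_const, lintegral_tsum]
        · congr 1
          · rw [ENNReal.ofReal_mul (by positivity), hω, measureReal_def,
              ENNReal.ofReal_toReal measure_ball_lt_top.ne]
          · congr 1
            ext j
            rw [lintegral_const_mul' _ _ ENNReal.ofReal_ne_top]
        · exact fun j => ((measurable_one.indicator (hmeas j)).const_mul _).aemeasurable
    _ ≤ ENNReal.ofReal (3 ^ γ * ω) + ∑' j : ℕ, ENNReal.ofReal (6 ^ γ * K * ω * b ^ j) := by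
        gcongr with j
        calc _ ≤ ENNReal.ofReal ((6 : ℝ) ^ γ * ((2 : ℝ) ^ γ) ^ j) *
              ENNReal.ofReal (K * (2 ^ (-m)) ^ j * ω) := by
              gcongr
              refine (setLIntegral_le_lintegral _ _).trans ?_
              rw [lintegral_indicator_one (hmeas j)]
              exact hvol j
          _ = _ := by
              rw [← ENNReal.ofReal_mul (by positivity)]
              congr 1
              rw [hb, mul_pow]; ring
    _ = _ := by
        rw [ENNReal.ofReal_tsum_of_nonneg (fun j => by positivity)
          ((summable_geometric_of_lt_one hb0 hb1).mul_left _)]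

/-- Uniform local integrability of the subcritical kernel `‖x - y‖^{δ - n}`. -/
lemma exists_lintegral_riesz_le {n : ℕ} (hn : 2 ≤ n) {δ : ℝ} (hδ : 0 < δ) :
    ∃ C : ℝ≥0∞, C ≠ ⊤ ∧ ∀ x ∈ ball (0 : Rn n) 1,
      ∫⁻ y in ball (0 : Rn n) 1, ENNReal.ofReal (‖x - y‖ ^ (δ - n)) ≤ C := by
  have : Nonempty (Fin n) := ⟨⟨0, by omega⟩⟩
  have hint : IntegrableOn (fun z : Rn n => ‖z‖ ^ (δ - n)) (ball 0 2) := by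
    rw [integrableOn_fun_norm_addHaar volume (f := fun t : ℝ => t ^ (δ - n)),
      finrank_euclideanSpace_fin]
    have : IntegrableOn (fun y : ℝ => y ^ (δ - 1)) (Ioo 0 2) :=
      (intervalIntegral.integrableOn_Ioo_rpow_iff (by norm_num)).2 (by linarith)
    refine this.congr_fun (fun y hy => ?_) measurableSet_Ioo
    simp only [smul_eq_mul]
    rw [← Real.rpow_natCast, ← Real.rpow_add hy.1, Nat.cast_sub (by omega)]
    congr 1
    push_cast; ring
  refine ⟨∫⁻ z in ball (0 : Rn n) 2, ENNReal.ofReal (‖z‖ ^ (δ - n)), ?_, fun x hx => ?_⟩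
  · have := hint.2
    rw [hasFiniteIntegral_iff_ofReal (Eventually.of_forall fun z => by positivity)] at this
    exact this.ne
  · rw [← lintegral_indicator measurableSet_ball, ← lintegral_indicator measurableSet_ball,
      ← lintegral_sub_left_eq_self _ x]
    refine lintegral_mono fun y => ?_
    by_cases hy : x - y ∈ ball (0 : Rn n) 1
    · have : y ∈ ball (0 : Rn n) 2 := by
        rw [mem_ball_zero_iff] at hx hy ⊢
        calc ‖y‖ = ‖x - (x - y)‖ := by congr 1; abel
          _ ≤ ‖x‖ + ‖x - y‖ := norm_sub_le _ _
          _ < 2 := by linarith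
      rw [indicator_of_mem hy, indicator_of_mem this, sub_sub_cancel]
    · rw [indicator_of_notMem hy]
      exact zero_le

/-- The Young inequality splitting the fractional difference quotient. -/
lemma fractional_young {ν s p ξ q q' h δ D N ρ : ℝ} (hξ : 1 < ξ)
    (hq : 1 ≤ q) (hqq' : q ≤ q') (hq'p : q' < p) (hδ : 0 < δ) (hh : 0 < h) (hhs : h ≤ s - δ)
    (hD : 0 ≤ D) (hN : 1 ≤ N) (hρ0 : 0 < ρ) (hρ2 : ρ ≤ 2) :
    D ^ q / ρ ^ (ν + h * q) ≤ D ^ p / N ^ ξ / ρ ^ (ν + s * p) +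
      2 ^ (s * q' * p / (p - q')) * (N ^ (ξ * q' / (p - q')) * ρ ^ (δ - ν)) := by
  have hp : 0 < p := by linarith
  have hpq : 0 < p - q := by linarith
  have hpq' : 0 < p - q' := by linarith
  have hN0 : 0 < N := by linarith
  have hq'0 : 0 ≤ q' := by linarith
  have hξ0 : 0 ≤ ξ := by linarith
  set e := (s - h) * q * p / (p - q) with he
  have hδe : δ ≤ e := by
    rw [he, le_div_iff₀ hpq]
    have h1 : δ * (p - q) ≤ δ * p := by nlinarith
    have h2 : δ * p ≤ (s - h) * p := by nlinarith
    have h3 : (s - h) * p ≤ (s - h) * p * q := by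
      have : 0 ≤ (s - h) * p := mul_nonneg (by linarith) hp.le
      nlinarith
    linarith
  have heq' : e ≤ s * q' * p / (p - q') := by
    have h0 : 0 ≤ s - h := by linarith
    have h1 : 0 ≤ s := by linarith
    have h2 : s - h ≤ s := by linarith
    have h3 : p - q' ≤ p - q := by linarith
    rw [he]
    gcongr
  have hγ : ξ * q / (p - q) ≤ ξ * q' / (p - q') := by
    have h3 : p - q' ≤ p - q := by linarith
    gcongr
  set X := D ^ p / N ^ ξ / ρ ^ (ν + s * p) with hX
  set Y := N ^ (ξ * q / (p - q)) * ρ ^ (e - ν) with hY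
  have hX0 : 0 ≤ X := by positivity
  have hY0 : 0 ≤ Y := by positivity
  have hprod : D ^ q / ρ ^ (ν + h * q) = X ^ (q / p) * Y ^ ((p - q) / p) := by
    rw [hX, hY, Real.div_rpow (by positivity) (by positivity),
      Real.div_rpow (by positivity) (by positivity), Real.mul_rpow (by positivity) (by positivity),
      ← Real.rpow_mul hD, ← Real.rpow_mul hN0.le, ← Real.rpow_mul hρ0.le, ← Real.rpow_mul hN0.le,
      ← Real.rpow_mul hρ0.le]
    have e1 : p * (q / p) = q := by field_simp
    have e2 : ξ * q / (p - q) * ((p - q) / p) = ξ * (q / p) := by field_simp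
    have e3 : (e - ν) * ((p - q) / p) = (ν + s * p) * (q / p) - (ν + h * q) := by
      rw [he]; field_simp; ring
    rw [e1, e2, e3, Real.rpow_sub hρ0]
    field_simp
  have hwt : q / p + (p - q) / p = 1 := by field_simp; ring
  have hY2 : Y ≤ 2 ^ (s * q' * p / (p - q')) * (N ^ (ξ * q' / (p - q')) * ρ ^ (δ - ν)) := by
    have h1 : N ^ (ξ * q / (p - q)) ≤ N ^ (ξ * q' / (p - q')) :=
      Real.rpow_le_rpow_of_exponent_le hN hγ
    have h2 : ρ ^ (e - δ) ≤ 2 ^ (s * q' * p / (p - q')) :=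
      (Real.rpow_le_rpow hρ0.le hρ2 (by linarith)).trans
        (Real.rpow_le_rpow_of_exponent_le (by norm_num) (by linarith))
    have h3 : ρ ^ (e - ν) = ρ ^ (e - δ) * ρ ^ (δ - ν) := by
      rw [← Real.rpow_add hρ0]; congr 1; ring
    rw [hY, h3]
    calc N ^ (ξ * q / (p - q)) * (ρ ^ (e - δ) * ρ ^ (δ - ν))
        ≤ N ^ (ξ * q' / (p - q')) * (2 ^ (s * q' * p / (p - q')) * ρ ^ (δ - ν)) := by gcongr
      _ = _ := by ring
  rw [hprod]
  refine (Real.geom_mean_le_arith_mean2_weighted (by positivity) (by positivity) hX0 hY0 hwt).trans ?_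
  have hq1 : q / p ≤ 1 := (div_le_one hp).2 (by linarith)
  have hq2 : (p - q) / p ≤ 1 := (div_le_one hp).2 (by linarith)
  refine add_le_add ?_ (le_trans ?_ hY2)
  · exact mul_le_of_le_one_left hX0 hq1
  · exact mul_le_of_le_one_left hY0 hq2

/-- The fractional gradient estimate on the unit ball. -/
lemma exists_fractional_le_unit {n : ℕ} (hn : 2 ≤ n) {s p ξ C₁ θ q' δ : ℝ} (hs : 0 < s)
    (hp : 0 < p) (hξ : 1 < ξ) (hξp : ξ ≤ p) (hθ0 : 0 ≤ θ) (hθ1 : θ < 1) (hθβ : θ ≤ s * p / n)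
    (hq' : 1 ≤ q') (hq'p : q' < p) (hγ : ξ * q' / (p - q') < (p - 1) / (1 - θ)) (hδ : 0 < δ) :
    ∃ C : ℝ≥0∞, C ≠ ⊤ ∧ ∀ w : Rn n → ℝ, Measurable w → (∀ x, x ∉ ball (0 : Rn n) 1 → w x = 0) →
      (∀ k : ℝ, 0 < k → (∫⁻ x, ∫⁻ y, ENNReal.ofReal
        (|w x - w y| ^ p / (k + |w x| + |w y|) ^ ξ / ‖x - y‖ ^ ((n : ℝ) + s * p))) ≤
          ENNReal.ofReal (C₁ * k ^ (1 - ξ))) →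
      ∀ h q : ℝ, 0 < h → h ≤ s - δ → 1 ≤ q → q ≤ q' →
        ∫⁻ x in ball (0 : Rn n) 1, ∫⁻ y in ball (0 : Rn n) 1,
          ENNReal.ofReal (|w x - w y| ^ q / ‖x - y‖ ^ ((n : ℝ) + h * q)) ≤ C := by
  have hγ0 : 0 < ξ * q' / (p - q') := div_pos (by positivity) (by linarith)
  obtain ⟨C2, hC2, H2⟩ := exists_lintegral_rpow_le (C₁ := C₁) hn (mul_pos hs hp) hξ hξp hθ0 hθ1
    hθβ hγ0 hγ
  obtain ⟨C3, hC3, H3⟩ := exists_lintegral_riesz_le hn hδ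
  set γ := ξ * q' / (p - q') with hγdef
  set c := (2 : ℝ) ^ (s * q' * p / (p - q')) with hc
  have hc0 : 0 < c := by positivity
  refine ⟨ENNReal.ofReal C₁ + ENNReal.ofReal c * (2 * (C2 * C3)), ?_, ?_⟩
  · finiteness
  intro w hw hw0 hE h q hh hhs hq hqq'
  have H2 := H2 w hw hw0 hE
  set B := ball (0 : Rn n) 1 with hB
  set f : Rn n → ℝ≥0∞ := fun x => ENNReal.ofReal ((1 + 2 * |w x|) ^ γ) with hf
  set k : Rn n → Rn n → ℝ≥0∞ := fun x y => ENNReal.ofReal (‖x - y‖ ^ (δ - n)) with hk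
  have hfm : Measurable f := by
    simp only [hf]; fun_prop
  have hkm : Measurable (Function.uncurry k) := by
    simp only [hk, Function.uncurry_def]; fun_prop
  have hkm1 : ∀ x, Measurable (k x) := fun x => hkm.of_uncurry_left
  have hI1 : ∫⁻ x in B, ∫⁻ y in B, f x * k x y ≤ C2 * C3 := by
    calc _ ≤ ∫⁻ x in B, f x * C3 := by
          refine setLIntegral_mono' measurableSet_ball fun x hx => ?_
          rw [lintegral_const_mul _ (hkm1 x)]
          gcongr
          exact H3 x hx
      _ ≤ _ := by
          rw [lintegral_mul_const _ hfm]
          gcongr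
  have hI2 : ∫⁻ x in B, ∫⁻ y in B, f y * k x y ≤ C2 * C3 := by
    rw [lintegral_lintegral_swap]
    · refine le_trans (le_of_eq ?_) hI1
      simp only [hk, norm_sub_rev]
    · exact ((hfm.comp measurable_snd).mul hkm).aemeasurable
  calc _ ≤ ∫⁻ x in B, ∫⁻ y in B, (ENNReal.ofReal
        (|w x - w y| ^ p / (1 + |w x| + |w y|) ^ ξ / ‖x - y‖ ^ ((n : ℝ) + s * p)) +
          ENNReal.ofReal c * (f x * k x y + f y * k x y)) := by
        refine setLIntegral_mono' measurableSet_ball fun x hx =>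
          setLIntegral_mono' measurableSet_ball fun y hy => ?_
        rcases eq_or_ne x y with rfl | hxy
        · rw [sub_self, abs_zero, Real.zero_rpow (by linarith), zero_div, ENNReal.ofReal_zero]
          exact zero_le
        have hρ0 : 0 < ‖x - y‖ := norm_pos_iff.2 (sub_ne_zero.2 hxy)
        have hρ2 : ‖x - y‖ ≤ 2 := by
          have h1 := mem_ball_zero_iff.1 hx
          have h2 := mem_ball_zero_iff.1 hy
          linarith [norm_sub_le x y]
        have hN : 1 ≤ 1 + |w x| + |w y| := by
          linarith [abs_nonneg (w x), abs_nonneg (w y)]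
        have hy := fractional_young (ν := n) hξ hq hqq' hq'p hδ hh hhs (abs_nonneg (w x - w y)) hN
          hρ0 hρ2
        refine (ENNReal.ofReal_le_ofReal hy).trans ?_
        rw [ENNReal.ofReal_add (by positivity) (by positivity), ENNReal.ofReal_mul hc0.le]
        gcongr
        rw [ENNReal.ofReal_mul (by positivity), ← add_mul]
        simp only [hk, hf]
        gcongr
        rw [← ENNReal.ofReal_add (by positivity) (by positivity)]
        refine ENNReal.ofReal_le_ofReal ?_
        have t1 : 0 ≤ (1 + 2 * |w x|) ^ γ := by positivity
        have t2 : 0 ≤ (1 + 2 * |w y|) ^ γ := by positivity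
        rcases le_total |w x| |w y| with hle | hle
        · exact (Real.rpow_le_rpow (by positivity) (by linarith) hγ0.le).trans
            (le_add_of_nonneg_left t1)
        · exact (Real.rpow_le_rpow (by positivity) (by linarith) hγ0.le).trans
            (le_add_of_nonneg_right t2)
    _ = (∫⁻ x in B, ∫⁻ y in B, ENNReal.ofReal
        (|w x - w y| ^ p / (1 + |w x| + |w y|) ^ ξ / ‖x - y‖ ^ ((n : ℝ) + s * p))) +
          ENNReal.ofReal c * ((∫⁻ x in B, ∫⁻ y in B, f x * k x y) +
            ∫⁻ x in B, ∫⁻ y in B, f y * k x y) := by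
        have m1 : Measurable (Function.uncurry fun x y : Rn n => f x * k x y) :=
          (hfm.comp measurable_fst).mul hkm
        have m2 : Measurable (Function.uncurry fun x y : Rn n => f y * k x y) :=
          (hfm.comp measurable_snd).mul hkm
        have m3 : Measurable (Function.uncurry fun x y : Rn n =>
            ENNReal.ofReal c * (f x * k x y + f y * k x y)) := (m1.add m2).const_mul _
        have m4 : ∀ x, Measurable fun y => f x * k x y + f y * k x y := fun x =>
          ((hkm1 x).const_mul _).add (hfm.mul (hkm1 x))
        rw [lintegral_congr fun x => lintegral_add_right _ m3.of_uncurry_left,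
          lintegral_add_right _ (Measurable.lintegral_prod_right m3)]
        congr 1
        rw [lintegral_congr fun x => lintegral_const_mul _ (m4 x),
          lintegral_const_mul _ (Measurable.lintegral_prod_right (m1.add m2)),
          lintegral_congr fun x => lintegral_add_left m1.of_uncurry_left _,
          lintegral_add_left (Measurable.lintegral_prod_right m1)]
    _ ≤ _ := by
        gcongr
        · refine le_trans ?_ ((hE 1 one_pos).trans (by rw [Real.one_rpow, mul_one]))
          exact (setLIntegral_le_lintegral _ _).trans
            (lintegral_mono fun x => setLIntegral_le_lintegral _ _)
        · rw [two_mul]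
          gcongr

lemma lintegral_eq_scale {n : ℕ} (x₀ : Rn n) {r : ℝ} (hr : 0 < r) (F : Rn n → ℝ≥0∞) :
    ∫⁻ x, F x = ENNReal.ofReal (r ^ n) * ∫⁻ x, F (x₀ + r • x) := by
  have h1 : ∫⁻ x, F (x₀ + x) = ∫⁻ x, F x := lintegral_add_left_eq_self _ x₀
  have hemb : MeasurableEmbedding (fun x : Rn n => r • x) :=
    (Homeomorph.smulOfNeZero r hr.ne').measurableEmbedding
  have h2 := hemb.lintegral_map (μ := (volume : Measure (Rn n))) (fun x => F (x₀ + x))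
  rw [← h2, Measure.map_addHaar_smul _ hr.ne', lintegral_smul_measure, h1,
    finrank_euclideanSpace_fin, smul_eq_mul, ← mul_assoc, ← ENNReal.ofReal_mul (by positivity),
    abs_of_pos (by positivity), mul_inv_cancel₀ (by positivity), ENNReal.ofReal_one, one_mul]

lemma setLIntegral_ball_eq_scale {n : ℕ} (x₀ : Rn n) {r : ℝ} (hr : 0 < r) (F : Rn n → ℝ≥0∞) :
    ∫⁻ x in ball x₀ r, F x = ENNReal.ofReal (r ^ n) * ∫⁻ x in ball (0 : Rn n) 1, F (x₀ + r • x) := by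
  rw [← lintegral_indicator measurableSet_ball, ← lintegral_indicator measurableSet_ball,
    lintegral_eq_scale x₀ hr]
  congr 2
  ext x
  have : x₀ + r • x ∈ ball x₀ r ↔ x ∈ ball (0 : Rn n) 1 := by
    rw [mem_ball_iff_norm, add_sub_cancel_left, mem_ball_zero_iff, norm_smul, Real.norm_eq_abs,
      abs_of_pos hr]
    exact mul_lt_iff_lt_one_right hr
  by_cases hx : x ∈ ball (0 : Rn n) 1
  · rw [indicator_of_mem hx, indicator_of_mem (this.2 hx)]
  · rw [indicator_of_notMem hx, indicator_of_notMem fun h => hx (this.1 h)]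

/-- The fractional gradient estimate on an arbitrary ball. -/
lemma exists_fractional_le_ball {n : ℕ} (hn : 2 ≤ n) {s p ξ C₁ θ q' δ : ℝ} (hs : 0 < s)
    (hp : 0 < p) (hξ : 1 < ξ) (hξp : ξ ≤ p) (hθ0 : 0 ≤ θ) (hθ1 : θ < 1) (hθβ : θ ≤ s * p / n)
    (hq' : 1 ≤ q') (hq'p : q' < p) (hγ : ξ * q' / (p - q') < (p - 1) / (1 - θ)) (hδ : 0 < δ)
    (hC₁ : 0 ≤ C₁) :
    ∃ C : ℝ, 0 < C ∧ ∀ (w : Rn n → ℝ) (x₀ : Rn n) (r d M : ℝ), Measurable w → 0 < r → 0 < d →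
      M ≤ d ^ (p - 1) * r ^ ((n : ℝ) - s * p) → (∀ x, x ∉ ball x₀ r → w x = 0) →
      (∀ k : ℝ, 0 < k → (∫⁻ x, ∫⁻ y, ENNReal.ofReal
        (|w x - w y| ^ p / (k + |w x| + |w y|) ^ ξ / ‖x - y‖ ^ ((n : ℝ) + s * p))) ≤
          ENNReal.ofReal (C₁ * k ^ (1 - ξ) * M)) →
      ∀ h q : ℝ, 0 < h → h ≤ s - δ → 1 ≤ q → q ≤ q' →
        ((volume (ball x₀ r))⁻¹ * ∫⁻ x in ball x₀ r, ∫⁻ y in ball x₀ r,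
          ENNReal.ofReal (|w x - w y| ^ q / ‖x - y‖ ^ ((n : ℝ) + h * q))) ^ (1 / q) ≤
        ENNReal.ofReal (C / r ^ h) * ENNReal.ofReal d := by
  have : Nonempty (Fin n) := ⟨⟨0, by omega⟩⟩
  obtain ⟨C₀, hC₀, H⟩ := exists_fractional_le_unit (C₁ := C₁) hn hs hp hξ hξp hθ0 hθ1 hθβ hq' hq'p
    hγ hδ
  set ω := volume.real (ball (0 : Rn n) 1) with hω
  have hω0 : 0 < ω := ENNReal.toReal_pos (measure_ball_pos _ _ one_pos).ne' measure_ball_lt_top.ne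
  refine ⟨max 1 (C₀.toReal / ω), by positivity, ?_⟩
  intro w x₀ r d M hw hr hd hM hw0 hE h q hh hhs hq hqq'
  set W : Rn n → ℝ := fun x => w (x₀ + r • x) / d with hW
  have hnorm : ∀ x y : Rn n, ‖(x₀ + r • x) - (x₀ + r • y)‖ = r * ‖x - y‖ := by
    intro x y
    rw [add_sub_add_left_eq_sub, ← smul_sub, norm_smul, Real.norm_eq_abs, abs_of_pos hr]
  have hwW : ∀ x, w (x₀ + r • x) = d * W x := fun x => by simp only [hW]; field_simp
  have hWm : Measurable W := (hw.comp (by fun_prop)).div_const d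
  have hW0 : ∀ x, x ∉ ball (0 : Rn n) 1 → W x = 0 := by
    intro x hx
    simp only [hW]
    rw [hw0, zero_div]
    rw [mem_ball_iff_norm, add_sub_cancel_left, norm_smul, Real.norm_eq_abs, abs_of_pos hr]
    rw [mem_ball_zero_iff] at hx
    exact fun h => hx ((mul_lt_iff_lt_one_right hr).1 h)
  have hdiff : ∀ x y, |w (x₀ + r • x) - w (x₀ + r • y)| = d * |W x - W y| := by
    intro x y
    rw [hwW, hwW, ← mul_sub, abs_mul, abs_of_pos hd]
  have hEW : ∀ k : ℝ, 0 < k → (∫⁻ x, ∫⁻ y, ENNReal.ofReal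
        (|W x - W y| ^ p / (k + |W x| + |W y|) ^ ξ / ‖x - y‖ ^ ((n : ℝ) + s * p))) ≤
          ENNReal.ofReal (C₁ * k ^ (1 - ξ)) := by
    intro k hk
    set T : ℝ := r ^ ((n : ℝ) - s * p) * d ^ (p - ξ) with hT
    have hT0 : 0 < T := by positivity
    have h1 : ∀ x y : Rn n, ENNReal.ofReal (|w (x₀ + r • x) - w (x₀ + r • y)| ^ p /
        (k * d + |w (x₀ + r • x)| + |w (x₀ + r • y)|) ^ ξ /
          ‖(x₀ + r • x) - (x₀ + r • y)‖ ^ ((n : ℝ) + s * p)) =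
        ENNReal.ofReal (d ^ (p - ξ) * (r ^ ((n : ℝ) + s * p))⁻¹) * ENNReal.ofReal
        (|W x - W y| ^ p / (k + |W x| + |W y|) ^ ξ / ‖x - y‖ ^ ((n : ℝ) + s * p)) := by
      intro x y
      rw [← ENNReal.ofReal_mul (by positivity)]
      congr 1
      rw [hdiff, hnorm, hwW, hwW, abs_mul, abs_mul, abs_of_pos hd,
        show k * d + d * |W x| + d * |W y| = d * (k + |W x| + |W y|) by ring,
        Real.mul_rpow hd.le (by positivity), Real.mul_rpow hd.le (by positivity),
        Real.mul_rpow hr.le (by positivity), Real.rpow_sub hd]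
      simp only [div_eq_mul_inv, mul_inv]
      ring
    have h2 := hE (k * d) (by positivity)
    rw [lintegral_eq_scale x₀ hr] at h2
    simp_rw [fun x => lintegral_eq_scale x₀ hr (fun y => ENNReal.ofReal
      (|w x - w y| ^ p / (k * d + |w x| + |w y|) ^ ξ / ‖x - y‖ ^ ((n : ℝ) + s * p))), h1] at h2
    simp_rw [lintegral_const_mul' _ _ ENNReal.ofReal_ne_top] at h2
    set I := ∫⁻ x, ∫⁻ y, ENNReal.ofReal
        (|W x - W y| ^ p / (k + |W x| + |W y|) ^ ξ / ‖x - y‖ ^ ((n : ℝ) + s * p)) with hI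
    have h3 : ENNReal.ofReal T * I ≤ ENNReal.ofReal (C₁ * (k * d) ^ (1 - ξ) * M) := by
      refine le_trans (le_of_eq ?_) h2
      rw [← mul_assoc, ← mul_assoc, ← ENNReal.ofReal_mul (by positivity),
        ← ENNReal.ofReal_mul (by positivity)]
      congr 2
      rw [hT, ← Real.rpow_natCast, Real.rpow_sub hr, Real.rpow_add hr]
      field_simp
    calc I = ENNReal.ofReal T⁻¹ * (ENNReal.ofReal T * I) := by
          rw [← mul_assoc, ← ENNReal.ofReal_mul (by positivity), inv_mul_cancel₀ hT0.ne',
            ENNReal.ofReal_one, one_mul]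
      _ ≤ ENNReal.ofReal T⁻¹ * ENNReal.ofReal (C₁ * (k * d) ^ (1 - ξ) * M) := by gcongr
      _ = ENNReal.ofReal (T⁻¹ * (C₁ * (k * d) ^ (1 - ξ) * M)) := by
          rw [← ENNReal.ofReal_mul (by positivity)]
      _ ≤ ENNReal.ofReal (T⁻¹ * (C₁ * (k * d) ^ (1 - ξ) *
            (d ^ (p - 1) * r ^ ((n : ℝ) - s * p)))) := by
          gcongr
      _ = _ := by
          congr 1
          have : d ^ (1 - ξ) * d ^ (p - 1) = d ^ (p - ξ) := by
            rw [← Real.rpow_add hd]; congr 1; ring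
          rw [hT, Real.mul_rpow hk.le hd.le]
          calc _ = (r ^ ((n : ℝ) - s * p) * d ^ (p - ξ))⁻¹ * (C₁ * k ^ (1 - ξ) *
                ((d ^ (1 - ξ) * d ^ (p - 1)) * r ^ ((n : ℝ) - s * p))) := by ring
            _ = _ := by rw [this]; field_simp
  have hmain := H W hWm hW0 hEW h q hh hhs hq hqq'
  have h1 : ∀ x y : Rn n, ENNReal.ofReal (|w (x₀ + r • x) - w (x₀ + r • y)| ^ q /
          ‖(x₀ + r • x) - (x₀ + r • y)‖ ^ ((n : ℝ) + h * q)) =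
        ENNReal.ofReal (d ^ q * (r ^ ((n : ℝ) + h * q))⁻¹) * ENNReal.ofReal
        (|W x - W y| ^ q / ‖x - y‖ ^ ((n : ℝ) + h * q)) := by
    intro x y
    rw [← ENNReal.ofReal_mul (by positivity)]
    congr 1
    rw [hdiff, hnorm, Real.mul_rpow hd.le (by positivity), Real.mul_rpow hr.le (by positivity)]
    simp only [div_eq_mul_inv, mul_inv]
    ring
  rw [setLIntegral_ball_eq_scale x₀ hr]
  simp_rw [fun x => setLIntegral_ball_eq_scale x₀ hr (fun y => ENNReal.ofReal
      (|w x - w y| ^ q / ‖x - y‖ ^ ((n : ℝ) + h * q))), h1]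
  simp_rw [lintegral_const_mul' _ _ ENNReal.ofReal_ne_top]
  rw [volume_ball_rn x₀ hr, ← hω, ← ENNReal.ofReal_inv_of_pos (by positivity)]
  have hq0 : 0 < q := by linarith
  calc _ ≤ (ENNReal.ofReal (r ^ (n : ℝ) * ω)⁻¹ * (ENNReal.ofReal (r ^ n) *
          (ENNReal.ofReal (r ^ n) * (ENNReal.ofReal (d ^ q * (r ^ ((n : ℝ) + h * q))⁻¹) *
            ENNReal.ofReal C₀.toReal)))) ^ (1 / q) := by
        rw [ENNReal.ofReal_toReal hC₀]
        gcongr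
    _ = ENNReal.ofReal ((C₀.toReal / ω) ^ (1 / q) * (d / r ^ h)) := by
        rw [← ENNReal.ofReal_mul (by positivity), ← ENNReal.ofReal_mul (by positivity),
          ← ENNReal.ofReal_mul (by positivity), ← ENNReal.ofReal_mul (by positivity),
          ENNReal.ofReal_rpow_of_nonneg (by positivity) (by positivity)]
        congr 1
        have e : (r ^ (n : ℝ) * ω)⁻¹ * (r ^ n * (r ^ n * (d ^ q * (r ^ ((n : ℝ) + h * q))⁻¹ *
            C₀.toReal))) = C₀.toReal / ω * (d / r ^ h) ^ q := by
          rw [Real.div_rpow hd.le (by positivity), ← Real.rpow_mul hr.le, Real.rpow_add hr,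
            Real.rpow_natCast]
          field_simp
        rw [e, Real.mul_rpow (by positivity) (by positivity), ← Real.rpow_mul (by positivity),
          mul_one_div_cancel hq0.ne', Real.rpow_one]
    _ ≤ ENNReal.ofReal (max 1 (C₀.toReal / ω) * (d / r ^ h)) := by
        gcongr
        have h1q : 1 / q ≤ 1 := (div_le_one hq0).2 hq
        calc (C₀.toReal / ω) ^ (1 / q) ≤ (max 1 (C₀.toReal / ω)) ^ (1 / q) := by
              gcongr
              exact le_max_right _ _
          _ ≤ (max 1 (C₀.toReal / ω)) ^ (1 : ℝ) :=
              Real.rpow_le_rpow_of_exponent_le (le_max_left _ _) h1q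
          _ = _ := Real.rpow_one _
    _ = _ := by
        rw [← ENNReal.ofReal_mul (by positivity)]
        congr 1
        ring

theorem abs_integral_rpow_le {α : Type*} [MeasurableSpace α] (P : Measure α)
    [IsProbabilityMeasure P] {g : α → ℝ} {B p : ℝ} (hp : 1 ≤ p) (hg : Measurable g)
    (hB : ∀ t, |g t| ≤ B) : |∫ t, g t ∂P| ^ p ≤ ∫ t, |g t| ^ p ∂P := by
  have hint : Integrable (fun t => |g t|) P :=
    Integrable.of_bound (by fun_prop) B (.of_forall fun t => by simpa using hB t)
  have hintp : Integrable (fun t => |g t| ^ p) P := by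
    refine Integrable.of_bound (Measurable.aestronglyMeasurable (by fun_prop)) (B ^ p) (.of_forall fun t => ?_)
    rw [Real.norm_of_nonneg (by positivity)]
    exact Real.rpow_le_rpow (abs_nonneg _) (hB t) (by linarith)
  calc |∫ t, g t ∂P| ^ p ≤ (∫ t, |g t| ∂P) ^ p := by
        gcongr
        exact abs_integral_le_integral_abs
    _ ≤ _ := (convexOn_rpow hp).map_integral_le (s := Ici 0) (f := fun t => |g t|)
        (Real.continuous_rpow_const (by linarith)).continuousOn isClosed_Ici
        (.of_forall fun t => abs_nonneg (g t)) hint hintp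

theorem lintegral_comp_add_smul_le {n : ℕ} (a : Rn n) {l : ℝ} (hl : 1 ≤ l) (F : Rn n → ℝ≥0∞) :
    ∫⁻ x, F (a + l • x) ≤ ∫⁻ x, F x := by
  rw [lintegral_eq_scale a (by linarith : 0 < l) F]
  refine le_mul_of_one_le_left' ?_
  rw [ENNReal.one_le_ofReal]
  exact one_le_pow₀ hl

/-- Averaging over translations and dilations does not increase the Gagliardo energy much. -/
theorem energy_average_le {n : ℕ} {p γ B l : ℝ} (hp : 1 ≤ p) (hγ : 0 ≤ γ) (hl : 1 ≤ l) (hl2 : l ≤ 2)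
    (P : Measure (Rn n)) [IsProbabilityMeasure P] {f : Rn n → ℝ} (hf : Measurable f)
    (hB : ∀ x, |f x| ≤ B) (b : Rn n) :
    ∫⁻ x : Rn n, ∫⁻ y : Rn n, ENNReal.ofReal
        (|(∫ t, f (b + l • x - t) ∂P) - ∫ t, f (b + l • y - t) ∂P| ^ p / ‖x - y‖ ^ γ) ≤
      ENNReal.ofReal (2 ^ γ) *
        ∫⁻ x : Rn n, ∫⁻ y : Rn n, ENNReal.ofReal (|f x - f y| ^ p / ‖x - y‖ ^ γ) := by
  have hl0 : 0 < l := by linarith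
  set S := ∫⁻ x : Rn n, ∫⁻ y : Rn n, ENNReal.ofReal (|f x - f y| ^ p / ‖x - y‖ ^ γ) with hS
  have hpt : ∀ x y : Rn n, ENNReal.ofReal
        (|(∫ t, f (b + l • x - t) ∂P) - ∫ t, f (b + l • y - t) ∂P| ^ p / ‖x - y‖ ^ γ) ≤
      ∫⁻ t, ENNReal.ofReal (|f (b + l • x - t) - f (b + l • y - t)| ^ p / ‖x - y‖ ^ γ) ∂P := by
    intro x y
    have hi : ∀ z : Rn n, Integrable (fun t => f (b + l • z - t)) P := fun z =>
      Integrable.of_bound (Measurable.aestronglyMeasurable (by fun_prop)) B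
        (.of_forall fun t => by simpa using hB _)
    have hB' : ∀ t, |f (b + l • x - t) - f (b + l • y - t)| ≤ 2 * B := fun t =>
      (abs_sub _ _).trans (by linarith [hB (b + l • x - t), hB (b + l • y - t)])
    have hint : Integrable
        (fun t => |f (b + l • x - t) - f (b + l • y - t)| ^ p / ‖x - y‖ ^ γ) P := by
      refine Integrable.of_bound (Measurable.aestronglyMeasurable (by fun_prop)) ((2 * B) ^ p / ‖x - y‖ ^ γ) (.of_forall fun t => ?_)
      rw [Real.norm_of_nonneg (by positivity)]
      gcongr
      exact hB' t
    rw [← ofReal_integral_eq_lintegral_ofReal hint (.of_forall fun t => by positivity),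
      integral_div, ← integral_sub (hi x) (hi y)]
    gcongr
    exact abs_integral_rpow_le P hp (by fun_prop) hB'
  have hswap1 : ∀ x : Rn n, ∫⁻ y : Rn n, ∫⁻ t, ENNReal.ofReal
        (|f (b + l • x - t) - f (b + l • y - t)| ^ p / ‖x - y‖ ^ γ) ∂P =
      ∫⁻ t, (∫⁻ y : Rn n, ENNReal.ofReal
        (|f (b + l • x - t) - f (b + l • y - t)| ^ p / ‖x - y‖ ^ γ)) ∂P := by
    intro x
    refine lintegral_lintegral_swap (Measurable.aemeasurable ?_)
    simp only [Function.uncurry_def]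
    fun_prop
  have hscale : ∀ t x : Rn n, ∫⁻ y : Rn n, ENNReal.ofReal
        (|f (b + l • x - t) - f (b + l • y - t)| ^ p / ‖x - y‖ ^ γ) ≤
      ENNReal.ofReal (2 ^ γ) * ∫⁻ y : Rn n, ENNReal.ofReal
        (|f ((b - t) + l • x) - f y| ^ p / ‖((b - t) + l • x) - y‖ ^ γ) := by
    intro t x
    refine le_trans ?_ (mul_le_mul_right (lintegral_comp_add_smul_le (b - t) hl _) _)
    rw [← lintegral_const_mul' _ _ ENNReal.ofReal_ne_top]
    refine lintegral_mono fun y => ?_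
    rw [← ENNReal.ofReal_mul (by positivity)]
    apply ENNReal.ofReal_le_ofReal
    have e1 : b + l • x - t = (b - t) + l • x := by abel
    have e2 : b + l • y - t = (b - t) + l • y := by abel
    have e3 : ‖((b - t) + l • x) - ((b - t) + l • y)‖ = l * ‖x - y‖ := by
      rw [add_sub_add_left_eq_sub, ← smul_sub, norm_smul, Real.norm_of_nonneg hl0.le]
    rw [e1, e2, e3, Real.mul_rpow hl0.le (norm_nonneg _)]
    have h1 : 1 ≤ 2 ^ γ / l ^ γ := by
      rw [one_le_div (by positivity)]
      gcongr
    calc _ ≤ (2 ^ γ / l ^ γ) * (|f ((b - t) + l • x) - f ((b - t) + l • y)| ^ p / ‖x - y‖ ^ γ) :=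
          le_mul_of_one_le_left (by positivity) h1
      _ = _ := by rw [div_mul_div_comm, mul_div_assoc]
  calc _ ≤ ∫⁻ x : Rn n, ∫⁻ y : Rn n, ∫⁻ t, ENNReal.ofReal
        (|f (b + l • x - t) - f (b + l • y - t)| ^ p / ‖x - y‖ ^ γ) ∂P :=
        lintegral_mono fun x => lintegral_mono fun y => hpt x y
    _ = ∫⁻ t, (∫⁻ x : Rn n, ∫⁻ y : Rn n, ENNReal.ofReal
        (|f (b + l • x - t) - f (b + l • y - t)| ^ p / ‖x - y‖ ^ γ)) ∂P := by
        simp_rw [hswap1]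
        refine lintegral_lintegral_swap (Measurable.aemeasurable ?_)
        exact Measurable.lintegral_prod_right' (f := fun z : (Rn n × Rn n) × Rn n =>
          ENNReal.ofReal (|f (b + l • z.1.1 - z.1.2) - f (b + l • z.2 - z.1.2)| ^ p /
            ‖z.1.1 - z.2‖ ^ γ)) (by fun_prop)
    _ ≤ ∫⁻ _, ENNReal.ofReal (2 ^ γ) * S ∂P := by
        refine lintegral_mono fun t => ?_
        calc _ ≤ ∫⁻ x : Rn n, ENNReal.ofReal (2 ^ γ) * ∫⁻ y : Rn n, ENNReal.ofReal
              (|f ((b - t) + l • x) - f y| ^ p / ‖((b - t) + l • x) - y‖ ^ γ) :=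
              lintegral_mono fun x => hscale t x
          _ = ENNReal.ofReal (2 ^ γ) * ∫⁻ x : Rn n, ∫⁻ y : Rn n, ENNReal.ofReal
              (|f ((b - t) + l • x) - f y| ^ p / ‖((b - t) + l • x) - y‖ ^ γ) :=
              lintegral_const_mul' _ _ ENNReal.ofReal_ne_top
          _ ≤ _ := by
              gcongr
              exact lintegral_comp_add_smul_le (b - t) hl (fun x => ∫⁻ y : Rn n, ENNReal.ofReal
                (|f x - f y| ^ p / ‖x - y‖ ^ γ))
    _ = _ := by simp

theorem isProbabilityMeasure_normed {n : ℕ} (ψ : ContDiffBump (0 : Rn n)) :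
    IsProbabilityMeasure (volume.withDensity (fun t => ENNReal.ofReal (ψ.normed volume t))) := by
  constructor
  rw [withDensity_apply _ MeasurableSet.univ, Measure.restrict_univ,
    ← ofReal_integral_eq_lintegral_ofReal ψ.integrable_normed (.of_forall ψ.nonneg_normed),
    ψ.integral_normed, ENNReal.ofReal_one]

theorem integral_normed_eq {n : ℕ} (ψ : ContDiffBump (0 : Rn n)) (g : Rn n → ℝ) :
    ∫ t, g t ∂(volume.withDensity (fun t => ENNReal.ofReal (ψ.normed volume t))) =
      ∫ t, ψ.normed volume t * g t := by
  rw [integral_withDensity_eq_integral_toReal_smul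
    (ψ.continuous_normed.measurable.ennreal_ofReal) (.of_forall fun _ => ENNReal.ofReal_lt_top)]
  simp_rw [ENNReal.toReal_ofReal (ψ.nonneg_normed _), smul_eq_mul]

/-- Approximation of a bounded function supported in a ball by test functions, with bounded
Gagliardo energies. -/
theorem exists_testFun_tendsto {n : ℕ} {p γ B r : ℝ} (hp : 1 ≤ p) (hγ : 0 ≤ γ) (hr : 0 < r)
    (x₀ : Rn n) {f : Rn n → ℝ} (hf : Measurable f) (hB : ∀ x, |f x| ≤ B)
    (hf0 : ∀ x, x ∉ ball x₀ r → f x = 0) :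
    ∃ φ : ℕ → Rn n → ℝ, (∀ j, IsTestFun n (ball x₀ r) (φ j)) ∧ (∀ j x, |φ j x| ≤ B) ∧
      (∀ᵐ x, Tendsto (fun j => φ j x) atTop (𝓝 (f x))) ∧
      ∀ j, ∫⁻ x : Rn n, ∫⁻ y : Rn n,
          ENNReal.ofReal (|φ j x - φ j y| ^ p / ‖x - y‖ ^ γ) ≤
        ENNReal.ofReal (2 ^ γ) *
          ∫⁻ x : Rn n, ∫⁻ y : Rn n, ENNReal.ofReal (|f x - f y| ^ p / ‖x - y‖ ^ γ) := by
  have hfloc : LocallyIntegrable f volume :=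
    (locallyIntegrable_const B).mono hf.aestronglyMeasurable
      (.of_forall fun x => by simpa using (hB x).trans (le_abs_self B))
  set ε : ℕ → ℝ := fun j => 1 / ((j : ℝ) + 1) with hε
  have hε0 : ∀ j, 0 < ε j := fun j => by simp only [hε]; positivity
  have hε1 : ∀ j, ε j ≤ 1 := fun j => by
    simp only [hε]
    rw [div_le_one (by positivity)]
    linarith [(Nat.cast_nonneg j : (0 : ℝ) ≤ j)]
  have hεt : Tendsto ε atTop (𝓝 0) := tendsto_one_div_add_atTop_nhds_zero_nat
  set ψ : ℕ → ContDiffBump (0 : Rn n) := fun j =>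
    ⟨r / 2 * ε j / 2, r / 2 * ε j, by have := hε0 j; positivity,
      by have := mul_pos (half_pos hr) (hε0 j); linarith⟩ with hψ
  have hout : ∀ j, (ψ j).rOut = r / 2 * ε j := fun j => rfl
  have hin : ∀ j, (ψ j).rIn = r / 2 * ε j / 2 := fun j => rfl
  set T : ℕ → Rn n → Rn n := fun j x => (x₀ - (1 + ε j) • x₀) + (1 + ε j) • x with hT
  have hTx : ∀ j x, T j x = x + ε j • (x - x₀) := fun j x => by
    simp only [hT, add_smul, one_smul, smul_sub]; abel
  have hTx0 : ∀ j x, T j x - x₀ = (1 + ε j) • (x - x₀) := fun j x => by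
    simp only [hT, add_smul, one_smul, smul_sub]; abel
  set φ : ℕ → Rn n → ℝ := fun j x => ∫ t, (ψ j).normed volume t * f (T j x - t) with hφ
  have hP := fun j => isProbabilityMeasure_normed (ψ j)
  have hφP : ∀ j x, φ j x = ∫ t, f (T j x - t)
      ∂(volume.withDensity (fun t => ENNReal.ofReal ((ψ j).normed volume t))) := fun j x =>
    (integral_normed_eq (ψ j) _).symm
  have hzero : ∀ j x, x ∉ closedBall x₀ ((r + r / 2 * ε j) / (1 + ε j)) → φ j x = 0 := by
    intro j x hx
    simp only [hφ]
    rw [integral_eq_zero_of_ae (.of_forall fun t => ?_)]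
    by_cases ht : t ∈ ball (0 : Rn n) (ψ j).rOut
    · have : T j x - t ∉ ball x₀ r := by
        intro hmem
        apply hx
        have := hε0 j
        rw [mem_closedBall, dist_eq_norm, le_div_iff₀ (by positivity)]
        rw [mem_ball, dist_eq_norm] at hmem
        rw [mem_ball_zero_iff, hout] at ht
        have e : ‖T j x - x₀‖ = ‖x - x₀‖ * (1 + ε j) := by
          rw [hTx0, norm_smul, Real.norm_of_nonneg (by positivity), mul_comm]
        rw [← e]
        calc ‖T j x - x₀‖ = ‖(T j x - t - x₀) + t‖ := by congr 1; abel
          _ ≤ ‖T j x - t - x₀‖ + ‖t‖ := norm_add_le _ _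
          _ ≤ _ := by linarith
      simp [hf0 _ this]
    · have : (ψ j).normed volume t = 0 := by
        rwa [← Function.notMem_support, (ψ j).support_normed_eq]
      simp [this]
  have hrad : ∀ j, (r + r / 2 * ε j) / (1 + ε j) < r := fun j => by
    have := hε0 j
    rw [div_lt_iff₀ (by positivity)]
    nlinarith [mul_pos hr this]
  have hts : ∀ j, tsupport (φ j) ⊆ closedBall x₀ ((r + r / 2 * ε j) / (1 + ε j)) := fun j =>
    closure_minimal (fun x hx => by_contra fun h => hx (hzero j x h)) isClosed_closedBall
  refine ⟨φ, fun j => ⟨?_, ?_, ?_⟩, fun j x => ?_, ?_, fun j => ?_⟩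
  · have h1 := (ψ j).hasCompactSupport_normed (μ := volume) |>.contDiff_convolution_left
      (n := (⊤ : ℕ∞)) (ContinuousLinearMap.lsmul ℝ ℝ) (ψ j).contDiff_normed hfloc
    have h2 : ContDiff ℝ ((⊤ : ℕ∞) : WithTop ℕ∞) (T j) := by
      simp only [hT]; fun_prop
    exact h1.comp h2
  · exact HasCompactSupport.of_support_subset_isCompact (isCompact_closedBall _ _)
      (subset_closure.trans (hts j))
  · exact (hts j).trans (closedBall_subset_ball (hrad j))
  · rw [hφP, ← Real.norm_eq_abs]
    have := hP j
    refine (norm_integral_le_of_norm_le_const (C := B) (.of_forall fun t => ?_)).trans (by simp)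
    exact hB _
  · filter_upwards [IsUnifLocDoublingMeasure.ae_tendsto_average_norm_sub volume hfloc 2] with x hx
    by_cases hxb : x ∈ ball x₀ r
    · have ht : Tendsto (fun j => r / 2 * ε j) atTop (𝓝[>] 0) := by
        refine tendsto_nhdsWithin_iff.2 ⟨by simpa using hεt.const_mul (r / 2), .of_forall fun j => ?_⟩
        exact mul_pos (half_pos hr) (hε0 j)
      have hav := hx (fun j => T j x) (fun j => r / 2 * ε j) ht (.of_forall fun j => by
        rw [mem_closedBall, dist_eq_norm, hTx, sub_add_cancel_left, norm_neg, norm_smul,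
          Real.norm_of_nonneg (hε0 j).le]
        rw [mem_ball, dist_eq_norm] at hxb
        nlinarith [hε0 j])
      have hrep : ∀ j, φ j x = ∫ y, (ψ j).normed volume (T j x - y) • f y := fun j =>
        convolution_lsmul_swap (μ := volume) (f := (ψ j).normed volume) (g := f) (x := T j x)
      simp_rw [hrep]
      refine tendsto_integral_smul_of_tendsto_average_norm_sub (2 ^ (Module.finrank ℝ (Rn n))) hav
        ?_ ?_ ?_ ?_
      · exact .of_forall fun j => hfloc.integrableOn_isCompact (isCompact_closedBall _ _)
      · refine tendsto_const_nhds.congr fun j => ?_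
        rw [integral_sub_left_eq_self (fun y => (ψ j).normed volume y) volume (T j x),
          (ψ j).integral_normed]
      · refine .of_forall fun j y hy => ?_
        have hy' : T j x - y ∈ Function.support ((ψ j).normed volume) := hy
        rw [(ψ j).support_normed_eq, mem_ball_zero_iff, hout] at hy'
        rw [mem_closedBall, dist_eq_norm, norm_sub_rev]
        exact hy'.le
      · refine .of_forall fun j y => ?_
        rw [abs_of_nonneg ((ψ j).nonneg_normed _)]
        have := (ψ j).normed_le_div_measure_closedBall_rOut volume 2
          (by rw [hout, hin]; linarith) (T j x - y)
        rw [hout] at this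
        rwa [Measure.addHaar_real_closedBall_center]
    · have : ∀ j, φ j x = 0 := fun j =>
        hzero j x fun h => hxb (closedBall_subset_ball (hrad j) h)
      simp [this, hf0 x hxb]
  · simp_rw [hφP]
    have := hP j
    exact energy_average_le hp hγ (by linarith [hε0 j]) (by linarith [hε1 j]) _ hf hB _

/-- A Fatou-type lemma for products whose negative part is controlled by a small multiple of a
bounded energy. -/
theorem lintegral_le_of_tendsto_of_absorb {Z : Type*} [MeasurableSpace Z] {ν : Measure Z}
    {H : Z → ℝ} {Hj E : ℕ → Z → ℝ} {m S : ℝ} (hm : 0 ≤ m) (hS : 0 ≤ S)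
    (hHm : Measurable H) (hH : ∀ z, 0 ≤ H z)
    (hHj : ∀ j, Integrable (Hj j) ν) (hE : ∀ j, Integrable (E j) ν) (hE0 : ∀ j z, 0 ≤ E j z)
    (hES : ∀ j, ∫ z, E j z ∂ν ≤ S) (hHjm : ∀ j, ∫ z, Hj j z ∂ν ≤ m)
    (hlim : ∀ᵐ z ∂ν, Tendsto (fun j => Hj j z) atTop (𝓝 (H z)))
    (habs : ∀ ε : ℝ, 0 < ε → ∃ Q : Z → ℝ, Measurable Q ∧ Integrable Q ν ∧ (∀ z, 0 ≤ Q z) ∧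
      ∀ j z, |Hj j z| ≤ ε * E j z + Q z) :
    ∫⁻ z, ENNReal.ofReal (H z) ∂ν ≤ ENNReal.ofReal m := by
  have key : ∀ ε : ℝ, 0 < ε → ∫⁻ z, ENNReal.ofReal (H z) ∂ν ≤ ENNReal.ofReal (m + ε * S) := by
    intro ε hε
    obtain ⟨Q, hQm, hQi, hQ0, hQ⟩ := habs ε hε
    have hq0 : 0 ≤ ∫ z, Q z ∂ν := integral_nonneg hQ0
    have hint : ∀ j, Integrable (fun z => Hj j z + ε * E j z + Q z) ν := fun j =>
      ((hHj j).add ((hE j).const_mul ε)).add hQi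
    have h0 : ∀ j z, 0 ≤ Hj j z + ε * E j z + Q z := fun j z => by
      linarith [neg_abs_le (Hj j z), hQ j z]
    have h1 : ∫⁻ z, ENNReal.ofReal (H z + Q z) ∂ν ≤
        ENNReal.ofReal (m + ε * S + ∫ z, Q z ∂ν) := by
      calc _ ≤ ∫⁻ z, liminf (fun j => ENNReal.ofReal (Hj j z + ε * E j z + Q z)) atTop ∂ν := by
            refine lintegral_mono_ae ?_
            filter_upwards [hlim] with z hz
            have ht : Tendsto (fun j => ENNReal.ofReal (Hj j z + Q z)) atTop
                (𝓝 (ENNReal.ofReal (H z + Q z))) :=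
              (ENNReal.continuous_ofReal.tendsto _).comp (hz.add_const _)
            rw [← ht.liminf_eq]
            refine liminf_le_liminf (.of_forall fun j => ENNReal.ofReal_le_ofReal ?_)
            have := mul_nonneg hε.le (hE0 j z)
            linarith
        _ ≤ liminf (fun j => ∫⁻ z, ENNReal.ofReal (Hj j z + ε * E j z + Q z) ∂ν) atTop :=
            lintegral_liminf_le' fun j => (hint j).aemeasurable.ennreal_ofReal
        _ ≤ _ := by
            refine liminf_le_of_le (by isBoundedDefault) fun b hb => ?_
            obtain ⟨j, hj⟩ := hb.exists
            refine hj.trans ?_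
            rw [← ofReal_integral_eq_lintegral_ofReal (hint j) (.of_forall (h0 j)),
              integral_add (f := fun z => Hj j z + ε * E j z)
                ((hHj j).add ((hE j).const_mul ε)) hQi,
              integral_add (hHj j) ((hE j).const_mul ε), integral_const_mul]
            gcongr
            exacts [hHjm j, hES j]
    have h2 : ∫⁻ z, ENNReal.ofReal (H z + Q z) ∂ν =
        ∫⁻ z, ENNReal.ofReal (H z) ∂ν + ENNReal.ofReal (∫ z, Q z ∂ν) := by
      rw [ofReal_integral_eq_lintegral_ofReal hQi (.of_forall hQ0),
        ← lintegral_add_left hHm.ennreal_ofReal]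
      simp_rw [fun z => ENNReal.ofReal_add (hH z) (hQ0 z)]
    rw [h2, ENNReal.ofReal_add (by positivity) hq0] at h1
    exact (ENNReal.add_le_add_iff_right ENNReal.ofReal_ne_top).1 h1
  refine ge_of_tendsto (x := 𝓝[>] (0 : ℝ)) (f := fun ε => ENNReal.ofReal (m + ε * S)) ?_
    (eventually_mem_nhdsWithin.mono fun ε hε => key ε hε)
  have : Tendsto (fun ε : ℝ => m + ε * S) (𝓝 0) (𝓝 (m + 0 * S)) :=
    (Continuous.tendsto (by fun_prop) _)
  simp only [zero_mul, add_zero] at this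
  exact ((ENNReal.continuous_ofReal.tendsto _).comp this).mono_left nhdsWithin_le_nhds

theorem rpow_sub_one_mul_le {a b t p : ℝ} (hp : 1 < p) (ha : 0 ≤ a) (hb : 0 ≤ b) (ht : 0 < t) :
    a ^ (p - 1) * b ≤ t ^ (p - 1) * b ^ p + t⁻¹ * a ^ p := by
  have e : ∀ c : ℝ, 0 ≤ c → c ^ (p - 1) * c = c ^ p := fun c hc => by
    rcases hc.eq_or_lt with rfl | hc
    · rw [Real.zero_rpow (by linarith : p ≠ 0), mul_zero]
    · rw [← Real.rpow_add_one hc.ne']; congr 1; ring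
  rcases le_or_gt a (t * b) with h | h
  · calc a ^ (p - 1) * b ≤ (t * b) ^ (p - 1) * b := by
          gcongr
      _ = t ^ (p - 1) * b ^ p := by
          rw [Real.mul_rpow ht.le hb, mul_assoc, e b hb]
      _ ≤ _ := le_add_of_nonneg_right (by positivity)
  · calc a ^ (p - 1) * b ≤ a ^ (p - 1) * (t⁻¹ * a) := by
          gcongr
          rw [inv_mul_eq_div, le_div_iff₀ ht]
          linarith
      _ = t⁻¹ * a ^ p := by rw [← e a ha]; ring
      _ ≤ _ := le_add_of_nonneg_left (by positivity)

theorem abs_signedPow {p : ℝ} (hp : 1 < p) (t : ℝ) : |(|t| ^ (p - 2) * t)| = |t| ^ (p - 1) := by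
  rw [abs_mul, abs_of_nonneg (by positivity : 0 ≤ |t| ^ (p - 2))]
  rcases (abs_nonneg t).eq_or_lt with h | h
  · rw [← h, mul_zero, Real.zero_rpow (by linarith)]
  · rw [← Real.rpow_add_one h.ne']; congr 1; ring

/-- The energy `∫∫ |a(x) - a(y)|^p |x - y|^{-γ}` as an integrability statement on the product. -/
theorem integrable_energy {n : ℕ} {p γ : ℝ} {a : Rn n → ℝ} (ha : Measurable a)
    (hE : ∫⁻ x : Rn n, ∫⁻ y : Rn n, ENNReal.ofReal (|a x - a y| ^ p / ‖x - y‖ ^ γ) < ⊤) :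
    Integrable (fun z : Rn n × Rn n => |a z.1 - a z.2| ^ p / ‖z.1 - z.2‖ ^ γ) ∧
      ENNReal.ofReal (∫ z : Rn n × Rn n, |a z.1 - a z.2| ^ p / ‖z.1 - z.2‖ ^ γ) =
        ∫⁻ x : Rn n, ∫⁻ y : Rn n, ENNReal.ofReal (|a x - a y| ^ p / ‖x - y‖ ^ γ) := by
  have hm : Measurable (fun z : Rn n × Rn n => |a z.1 - a z.2| ^ p / ‖z.1 - z.2‖ ^ γ) := by
    fun_prop
  have h0 : ∀ z : Rn n × Rn n, 0 ≤ |a z.1 - a z.2| ^ p / ‖z.1 - z.2‖ ^ γ := fun z => by positivity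
  have heq : ∫⁻ z : Rn n × Rn n, ENNReal.ofReal (|a z.1 - a z.2| ^ p / ‖z.1 - z.2‖ ^ γ) =
      ∫⁻ x : Rn n, ∫⁻ y : Rn n, ENNReal.ofReal (|a x - a y| ^ p / ‖x - y‖ ^ γ) := by
    rw [Measure.volume_eq_prod, lintegral_prod _ hm.ennreal_ofReal.aemeasurable]
  have hi : Integrable (fun z : Rn n × Rn n => |a z.1 - a z.2| ^ p / ‖z.1 - z.2‖ ^ γ) := by
    refine ⟨hm.aestronglyMeasurable, ?_⟩
    rw [hasFiniteIntegral_iff_ofReal (.of_forall h0), heq]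
    exact hE
  exact ⟨hi, by rw [ofReal_integral_eq_lintegral_ofReal hi (.of_forall h0), heq]⟩

theorem flux_le {p Λ γ : ℝ} {n : ℕ} (hp : 1 < p) (hΛ : 0 ≤ Λ) {K : Rn n → Rn n → ℝ}
    (hK0 : ∀ x y, x ≠ y → 0 ≤ K x y) (hK1 : ∀ x y, x ≠ y → K x y ≤ Λ / ‖x - y‖ ^ γ)
    (a φ : Rn n → ℝ) {t : ℝ} (ht : 0 < t) (z : Rn n × Rn n) :
    |(|a z.1 - a z.2| ^ (p - 2) * (a z.1 - a z.2)) * (φ z.1 - φ z.2) * K z.1 z.2| ≤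
      Λ * t ^ (p - 1) * (|φ z.1 - φ z.2| ^ p / ‖z.1 - z.2‖ ^ γ) +
        Λ * t⁻¹ * (|a z.1 - a z.2| ^ p / ‖z.1 - z.2‖ ^ γ) := by
  by_cases h : z.1 = z.2
  · rw [h, sub_self (φ z.2)]
    simp only [mul_zero, zero_mul, abs_zero]
    positivity
  · rw [abs_mul, abs_mul, abs_signedPow hp, abs_of_nonneg (hK0 _ _ h)]
    calc _ ≤ (t ^ (p - 1) * |φ z.1 - φ z.2| ^ p + t⁻¹ * |a z.1 - a z.2| ^ p) *
          (Λ / ‖z.1 - z.2‖ ^ γ) :=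
          mul_le_mul (rpow_sub_one_mul_le hp (abs_nonneg _) (abs_nonneg _) ht) (hK1 _ _ h)
            (hK0 _ _ h) (by positivity)
      _ = _ := by ring

set_option maxHeartbeats 1000000 in
/-- The difference of two weak equations may be tested with bounded functions of finite energy
vanishing outside the ball. -/
theorem lintegral_flux_diff_le {n : ℕ} {p Λ γ B r : ℝ} (hp : 2 ≤ p) (hΛ : 1 ≤ Λ) (hγ : 0 ≤ γ)
    (hr : 0 < r) (x₀ : Rn n) {K : Rn n → Rn n → ℝ} (hKm : Measurable (Function.uncurry K))
    (hK0 : ∀ x y, x ≠ y → 1 / (Λ * ‖x - y‖ ^ γ) ≤ K x y)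
    (hK1 : ∀ x y, x ≠ y → K x y ≤ Λ / ‖x - y‖ ^ γ)
    {u v μ f : Rn n → ℝ} (hu : Measurable u) (hv : Measurable v) (hf : Measurable f)
    (hμ : Integrable μ) (hB : ∀ x, |f x| ≤ B) (hf0 : ∀ x, x ∉ ball x₀ r → f x = 0)
    (huE : ∫⁻ x : Rn n, ∫⁻ y : Rn n, ENNReal.ofReal (|u x - u y| ^ p / ‖x - y‖ ^ γ) < ⊤)
    (hvE : ∫⁻ x : Rn n, ∫⁻ y : Rn n, ENNReal.ofReal (|v x - v y| ^ p / ‖x - y‖ ^ γ) < ⊤)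
    (hfE : ∫⁻ x : Rn n, ∫⁻ y : Rn n, ENNReal.ofReal (|f x - f y| ^ p / ‖x - y‖ ^ γ) < ⊤)
    (hweq : ∀ φ : Rn n → ℝ, IsTestFun n (ball x₀ r) φ →
      (∫ x : Rn n, ∫ y : Rn n,
        |u x - u y| ^ (p - 2) * (u x - u y) * (φ x - φ y) * K x y) = ∫ x : Rn n, φ x * μ x)
    (hweq' : ∀ φ : Rn n → ℝ, IsTestFun n (ball x₀ r) φ →
      (∫ x : Rn n, ∫ y : Rn n,
        |v x - v y| ^ (p - 2) * (v x - v y) * (φ x - φ y) * K x y) = 0)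
    (hpos : ∀ x y, 0 ≤ (|u x - u y| ^ (p - 2) * (u x - u y) -
      |v x - v y| ^ (p - 2) * (v x - v y)) * (f x - f y)) :
    ∫⁻ z : Rn n × Rn n, ENNReal.ofReal ((|u z.1 - u z.2| ^ (p - 2) * (u z.1 - u z.2) -
      |v z.1 - v z.2| ^ (p - 2) * (v z.1 - v z.2)) * (f z.1 - f z.2) * K z.1 z.2) ≤
      ENNReal.ofReal (B * ∫ x in ball x₀ r, |μ x|) := by
  have hB0 : 0 ≤ B := (abs_nonneg _).trans (hB 0)
  have hp1 : 1 < p := by linarith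
  have hΛ0 : 0 ≤ Λ := by linarith
  have hK0' : ∀ x y, x ≠ y → 0 ≤ K x y := fun x y h => le_trans (by positivity) (hK0 x y h)
  have hKm' : Measurable fun z : Rn n × Rn n => K z.1 z.2 := hKm
  obtain ⟨φ, hφt, hφB, hφlim, hφE⟩ := exists_testFun_tendsto (p := p) hp1.le hγ hr x₀ hf hB hf0
  have hφE' : ∀ j, ∫⁻ x : Rn n, ∫⁻ y : Rn n,
      ENNReal.ofReal (|φ j x - φ j y| ^ p / ‖x - y‖ ^ γ) < ⊤ := fun j =>
    (hφE j).trans_lt (ENNReal.mul_lt_top ENNReal.ofReal_lt_top hfE)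
  have hφm : ∀ j, Measurable (φ j) := fun j => (hφt j).1.continuous.measurable
  have hUi := (integrable_energy hu huE).1
  have hVi := (integrable_energy hv hvE).1
  have hEi := fun j => (integrable_energy (hφm j) (hφE' j)).1
  have hflux : ∀ a : Rn n → ℝ, Measurable a →
      Integrable (fun z : Rn n × Rn n => |a z.1 - a z.2| ^ p / ‖z.1 - z.2‖ ^ γ) → ∀ j,
      Integrable (fun z : Rn n × Rn n =>
        (|a z.1 - a z.2| ^ (p - 2) * (a z.1 - a z.2)) * (φ j z.1 - φ j z.2) * K z.1 z.2) := by
    intro a ha hai j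
    refine Integrable.mono' (((hEi j).const_mul (Λ * 1 ^ (p - 1))).add
      (hai.const_mul (Λ * 1⁻¹))) ?_ (.of_forall fun z => ?_)
    · have := hφm j
      exact Measurable.aestronglyMeasurable (by fun_prop)
    · exact flux_le hp1 hΛ0 hK0' hK1 a (φ j) one_pos z
  have hHjeq : ∀ j (z : Rn n × Rn n), (|u z.1 - u z.2| ^ (p - 2) * (u z.1 - u z.2) -
      |v z.1 - v z.2| ^ (p - 2) * (v z.1 - v z.2)) * (φ j z.1 - φ j z.2) * K z.1 z.2 =
      (|u z.1 - u z.2| ^ (p - 2) * (u z.1 - u z.2)) * (φ j z.1 - φ j z.2) * K z.1 z.2 -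
      (|v z.1 - v z.2| ^ (p - 2) * (v z.1 - v z.2)) * (φ j z.1 - φ j z.2) * K z.1 z.2 :=
    fun j z => by ring
  set S := ENNReal.ofReal (2 ^ γ) * ∫⁻ x : Rn n, ∫⁻ y : Rn n,
    ENNReal.ofReal (|f x - f y| ^ p / ‖x - y‖ ^ γ) with hS
  have hSt : S ≠ ⊤ := (ENNReal.mul_lt_top ENNReal.ofReal_lt_top hfE).ne
  refine lintegral_le_of_tendsto_of_absorb (S := S.toReal)
    (Hj := fun j z => (|u z.1 - u z.2| ^ (p - 2) * (u z.1 - u z.2) -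
      |v z.1 - v z.2| ^ (p - 2) * (v z.1 - v z.2)) * (φ j z.1 - φ j z.2) * K z.1 z.2)
    (E := fun j z => |φ j z.1 - φ j z.2| ^ p / ‖z.1 - z.2‖ ^ γ)
    (mul_nonneg hB0 (integral_nonneg fun x => abs_nonneg _)) ENNReal.toReal_nonneg
    (by fun_prop) (fun z => ?_) (fun j => ?_) hEi (fun j z => by positivity) (fun j => ?_)
    (fun j => ?_) ?_ (fun ε hε => ?_)
  · by_cases h : z.1 = z.2
    · simp [h]
    · exact mul_nonneg (hpos _ _) (hK0' _ _ h)
  · simp_rw [hHjeq]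
    exact (hflux u hu hUi j).sub (hflux v hv hVi j)
  · refine (ENNReal.ofReal_le_iff_le_toReal hSt).1 ?_
    rw [(integrable_energy (hφm j) (hφE' j)).2]
    exact hφE j
  · simp_rw [hHjeq]
    rw [integral_sub (hflux u hu hUi j) (hflux v hv hVi j), Measure.volume_eq_prod,
      integral_prod _ (hflux u hu hUi j), integral_prod _ (hflux v hv hVi j), hweq _ (hφt j),
      hweq' _ (hφt j), sub_zero]
    have hφ0 : ∀ x, x ∉ ball x₀ r → φ j x * μ x = 0 := fun x hx => by
      rw [image_eq_zero_of_notMem_tsupport (fun h => hx ((hφt j).2.2 h)), zero_mul]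
    rw [← setIntegral_eq_integral_of_forall_compl_eq_zero hφ0, ← integral_const_mul]
    have hb : Integrable (fun x => B * |μ x|) (volume.restrict (ball x₀ r)) :=
      (hμ.abs.const_mul B).integrableOn
    have hle : ∀ x, |φ j x * μ x| ≤ B * |μ x| := fun x => by
      rw [abs_mul]
      gcongr
      exact hφB j x
    refine integral_mono (hb.mono' ?_ (.of_forall hle)) hb fun x => (le_abs_self _).trans (hle x)
    exact ((hφm j).aestronglyMeasurable.mul hμ.aestronglyMeasurable).restrict
  · have h1 : ∀ᵐ z : Rn n × Rn n, Tendsto (fun j => φ j z.1) atTop (𝓝 (f z.1)) :=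
      Measure.quasiMeasurePreserving_fst.ae hφlim
    have h2 : ∀ᵐ z : Rn n × Rn n, Tendsto (fun j => φ j z.2) atTop (𝓝 (f z.2)) :=
      Measure.quasiMeasurePreserving_snd.ae hφlim
    filter_upwards [h1, h2] with z hz1 hz2
    exact ((hz1.sub hz2).const_mul _).mul_const _
  · set t := (ε / (2 * Λ)) ^ (1 / (p - 1)) with ht
    have hΛ1 : 0 < Λ := by linarith
    have ht0 : 0 < t := by positivity
    have htp : t ^ (p - 1) = ε / (2 * Λ) := by
      rw [ht, ← Real.rpow_mul (by positivity), one_div_mul_cancel (by linarith), Real.rpow_one]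
    refine ⟨fun z => Λ * t⁻¹ * (|u z.1 - u z.2| ^ p / ‖z.1 - z.2‖ ^ γ) +
      Λ * t⁻¹ * (|v z.1 - v z.2| ^ p / ‖z.1 - z.2‖ ^ γ), by fun_prop,
      (hUi.const_mul _).add (hVi.const_mul _), fun z => by positivity, fun j z => ?_⟩
    have a1 := flux_le hp1 hΛ0 hK0' hK1 u (φ j) ht0 z
    have a2 := flux_le hp1 hΛ0 hK0' hK1 v (φ j) ht0 z
    have e : Λ * t ^ (p - 1) = ε / 2 := by rw [htp]; field_simp
    rw [e] at a1 a2
    rw [hHjeq]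
    refine (abs_sub _ _).trans ?_
    linarith

/-- The energy estimate obtained by testing with a bounded function of `w = u - v`. -/
theorem lintegral_weighted_energy_le {n : ℕ} {p Λ γ ξ r : ℝ} (hp : 2 ≤ p) (hΛ : 1 ≤ Λ) (hγ : 0 ≤ γ)
    (hξ : 1 < ξ) (hr : 0 < r) (x₀ : Rn n) {K : Rn n → Rn n → ℝ}
    (hKm : Measurable (Function.uncurry K))
    (hK0 : ∀ x y, x ≠ y → 1 / (Λ * ‖x - y‖ ^ γ) ≤ K x y)
    (hK1 : ∀ x y, x ≠ y → K x y ≤ Λ / ‖x - y‖ ^ γ)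
    {u v μ : Rn n → ℝ} (hu : Measurable u) (hv : Measurable v) (hμ : Integrable μ)
    (huv : ∀ x, x ∉ ball x₀ r → u x - v x = 0)
    (huE : ∫⁻ x : Rn n, ∫⁻ y : Rn n, ENNReal.ofReal (|u x - u y| ^ p / ‖x - y‖ ^ γ) < ⊤)
    (hvE : ∫⁻ x : Rn n, ∫⁻ y : Rn n, ENNReal.ofReal (|v x - v y| ^ p / ‖x - y‖ ^ γ) < ⊤)
    (hweq : ∀ φ : Rn n → ℝ, IsTestFun n (ball x₀ r) φ →
      (∫ x : Rn n, ∫ y : Rn n,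
        |u x - u y| ^ (p - 2) * (u x - u y) * (φ x - φ y) * K x y) = ∫ x : Rn n, φ x * μ x)
    (hweq' : ∀ φ : Rn n → ℝ, IsTestFun n (ball x₀ r) φ →
      (∫ x : Rn n, ∫ y : Rn n,
        |v x - v y| ^ (p - 2) * (v x - v y) * (φ x - φ y) * K x y) = 0)
    {k : ℝ} (hk : 0 < k) :
    ∫⁻ x : Rn n, ∫⁻ y : Rn n, ENNReal.ofReal (|(u x - v x) - (u y - v y)| ^ p /
        (k + |u x - v x| + |u y - v y|) ^ ξ / ‖x - y‖ ^ γ) ≤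
      ENNReal.ofReal (Λ * 2 ^ (p - 1) / (ξ - 1) * k ^ (1 - ξ) * ∫ x in ball x₀ r, |μ x|) := by
  have hp0 : 0 < p := by linarith
  have hΛ0 : 0 < Λ := by linarith
  obtain ⟨G, hG0, hGB, hGc, hGs⟩ := exists_bounded_slope hk hξ
  set w : Rn n → ℝ := fun x => u x - v x with hw
  have hwm : Measurable w := hu.sub hv
  have hGw : Measurable fun x => G (w x) := hGc.measurable.comp hwm
  have hmono := abs_rpow_le_signedPow_sub_mul hp
  have hdw : ∀ x y, w x - w y = (u x - u y) - (v x - v y) := fun x y => by simp only [hw]; ring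
  have hfE : ∫⁻ x : Rn n, ∫⁻ y : Rn n,
      ENNReal.ofReal (|G (w x) - G (w y)| ^ p / ‖x - y‖ ^ γ) < ⊤ := by
    set c : ℝ := (k ^ (-ξ) * 2) ^ p with hc
    have hpt : ∀ x y : Rn n, ENNReal.ofReal (|G (w x) - G (w y)| ^ p / ‖x - y‖ ^ γ) ≤
        ENNReal.ofReal c * (ENNReal.ofReal (|u x - u y| ^ p / ‖x - y‖ ^ γ) +
          ENNReal.ofReal (|v x - v y| ^ p / ‖x - y‖ ^ γ)) := by
      intro x y
      rw [← ENNReal.ofReal_add (by positivity) (by positivity),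
        ← ENNReal.ofReal_mul (by positivity)]
      apply ENNReal.ofReal_le_ofReal
      rw [← add_div, ← mul_div_assoc]
      gcongr
      obtain ⟨m, hm, hm0, hm1⟩ := hGs (w x) (w y)
      have hm0' : 0 ≤ m := le_trans (by positivity) hm0
      set a := |u x - u y|
      set b := |v x - v y|
      have ha : 0 ≤ a := abs_nonneg _
      have hb : 0 ≤ b := abs_nonneg _
      have h1 : |G (w x) - G (w y)| ≤ k ^ (-ξ) * 2 * max a b := by
        rw [hm, abs_mul, abs_of_nonneg hm0', mul_assoc]
        gcongr
        rw [hdw]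
        refine (abs_sub _ _).trans ?_
        linarith [le_max_left a b, le_max_right a b]
      calc |G (w x) - G (w y)| ^ p ≤ (k ^ (-ξ) * 2 * max a b) ^ p := by gcongr
        _ = c * (max a b) ^ p := Real.mul_rpow (by positivity) (by positivity)
        _ ≤ _ := by
          gcongr
          rcases max_cases a b with ⟨h, -⟩ | ⟨h, -⟩ <;> rw [h]
          · exact le_add_of_nonneg_right (by positivity)
          · exact le_add_of_nonneg_left (by positivity)
    calc _ ≤ ∫⁻ x : Rn n, ∫⁻ y : Rn n, ENNReal.ofReal c *
          (ENNReal.ofReal (|u x - u y| ^ p / ‖x - y‖ ^ γ) +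
          ENNReal.ofReal (|v x - v y| ^ p / ‖x - y‖ ^ γ)) :=
          lintegral_mono fun x => lintegral_mono fun y => hpt x y
      _ = ENNReal.ofReal c * ((∫⁻ x : Rn n, ∫⁻ y : Rn n,
            ENNReal.ofReal (|u x - u y| ^ p / ‖x - y‖ ^ γ)) +
            ∫⁻ x : Rn n, ∫⁻ y : Rn n, ENNReal.ofReal (|v x - v y| ^ p / ‖x - y‖ ^ γ)) := by
          simp_rw [lintegral_const_mul' _ _ (ENNReal.ofReal_ne_top (r := c))]
          congr 1
          rw [← lintegral_add_left (Measurable.lintegral_prod_right' (f := fun z : Rn n × Rn n =>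
            ENNReal.ofReal (|u z.1 - u z.2| ^ p / ‖z.1 - z.2‖ ^ γ)) (by fun_prop))]
          refine lintegral_congr fun x => ?_
          rw [lintegral_add_left (by fun_prop)]
      _ < ⊤ := ENNReal.mul_lt_top ENNReal.ofReal_lt_top (ENNReal.add_lt_top.2 ⟨huE, hvE⟩)
  have hlow : ∀ x y, ∃ m, (k + |w x| + |w y|) ^ (-ξ) ≤ m ∧
      m * (2 ^ (1 - p) * |w x - w y| ^ p) ≤ (|u x - u y| ^ (p - 2) * (u x - u y) -
        |v x - v y| ^ (p - 2) * (v x - v y)) * (G (w x) - G (w y)) := by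
    intro x y
    obtain ⟨m, hm, hm0, -⟩ := hGs (w x) (w y)
    have hm0' : 0 ≤ m := le_trans (by positivity) hm0
    refine ⟨m, hm0, ?_⟩
    have := mul_le_mul_of_nonneg_left (hmono (u x - u y) (v x - v y)) hm0'
    rw [hm, hdw]
    linarith
  have hmain := lintegral_flux_diff_le (f := fun x => G (w x)) (μ := μ) hp hΛ hγ hr x₀ hKm hK0 hK1
    hu hv hGw hμ (fun x => hGB (w x)) (fun x hx => by simp only [hw, huv x hx, hG0])
    huE hvE hfE hweq hweq' (fun x y => by
      obtain ⟨m, hm0, hm⟩ := hlow x y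
      have hm0' : 0 ≤ m := le_trans (by positivity) hm0
      exact le_trans (by positivity) hm)
  have hpt : ∀ z : Rn n × Rn n, ENNReal.ofReal (|w z.1 - w z.2| ^ p /
        (k + |w z.1| + |w z.2|) ^ ξ / ‖z.1 - z.2‖ ^ γ) ≤ ENNReal.ofReal (Λ * 2 ^ (p - 1)) *
      ENNReal.ofReal ((|u z.1 - u z.2| ^ (p - 2) * (u z.1 - u z.2) -
      |v z.1 - v z.2| ^ (p - 2) * (v z.1 - v z.2)) * (G (w z.1) - G (w z.2)) * K z.1 z.2) := by
    intro z
    rw [← ENNReal.ofReal_mul (by positivity)]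
    apply ENNReal.ofReal_le_ofReal
    by_cases hz : z.1 = z.2
    · simp [hz, Real.zero_rpow hp0.ne']
    · obtain ⟨m, hm0, hm⟩ := hlow z.1 z.2
      have hm0' : 0 ≤ m := le_trans (by positivity) hm0
      have hK := hK0 z.1 z.2 hz
      have h2 : (2 : ℝ) ^ (p - 1) * 2 ^ (1 - p) = 1 := by
        rw [← Real.rpow_add two_pos, show p - 1 + (1 - p) = 0 by ring, Real.rpow_zero]
      calc |w z.1 - w z.2| ^ p / (k + |w z.1| + |w z.2|) ^ ξ / ‖z.1 - z.2‖ ^ γ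
          = (Λ * 2 ^ (p - 1)) * (((k + |w z.1| + |w z.2|) ^ (-ξ) *
              (2 ^ (1 - p) * |w z.1 - w z.2| ^ p)) * (1 / (Λ * ‖z.1 - z.2‖ ^ γ))) := by
            rw [Real.rpow_neg (by positivity)]
            calc _ = (2 ^ (p - 1) * 2 ^ (1 - p)) * (|w z.1 - w z.2| ^ p /
                (k + |w z.1| + |w z.2|) ^ ξ / ‖z.1 - z.2‖ ^ γ) := by rw [h2, one_mul]
              _ = _ := by field_simp
        _ ≤ (Λ * 2 ^ (p - 1)) * ((m * (2 ^ (1 - p) * |w z.1 - w z.2| ^ p)) * K z.1 z.2) := by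
            gcongr
        _ ≤ _ := by
            have : 0 ≤ K z.1 z.2 := le_trans (by positivity) hK
            gcongr
  have hprod : ∫⁻ x : Rn n, ∫⁻ y : Rn n, ENNReal.ofReal (|w x - w y| ^ p /
        (k + |w x| + |w y|) ^ ξ / ‖x - y‖ ^ γ) =
      ∫⁻ z : Rn n × Rn n, ENNReal.ofReal (|w z.1 - w z.2| ^ p /
        (k + |w z.1| + |w z.2|) ^ ξ / ‖z.1 - z.2‖ ^ γ) := by
    rw [Measure.volume_eq_prod, lintegral_prod _ (Measurable.aemeasurable (by fun_prop))]
  calc _ = _ := hprod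
    _ ≤ _ := lintegral_mono hpt
    _ = _ := lintegral_const_mul' _ _ ENNReal.ofReal_ne_top
    _ ≤ ENNReal.ofReal (Λ * 2 ^ (p - 1)) *
        ENNReal.ofReal (k ^ (1 - ξ) / (ξ - 1) * ∫ x in ball x₀ r, |μ x|) := by
        gcongr
    _ = _ := by
        rw [← ENNReal.ofReal_mul (by positivity)]
        congr 1
        ring

theorem exists_exponents {n : ℕ} {s p q : ℝ} (hn : 2 ≤ n) (hs : 0 < s) (hs1 : s < 1) (hp : 2 ≤ p)
    (hq : 1 ≤ q) (hqb : q < qBar n s p) :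
    ∃ ξ θ : ℝ, 1 < ξ ∧ ξ ≤ p ∧ 0 ≤ θ ∧ θ < 1 ∧ θ ≤ s * p / n ∧
      ξ * q / (p - q) < (p - 1) / (1 - θ) := by
  have hn' : (2 : ℝ) ≤ n := by exact_mod_cast hn
  obtain ⟨hq1, hqp⟩ := lt_min_iff.1 hqb
  rw [lt_div_iff₀ (by linarith)] at hq1
  have hpq : 0 < p - q := by linarith
  have hθ : ∃ θ : ℝ, 0 ≤ θ ∧ θ < 1 ∧ θ ≤ s * p / n ∧ q * (1 - θ) < (p - 1) * (p - q) := by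
    rcases lt_or_ge (s * p) n with h | h
    · refine ⟨s * p / n, by positivity, (div_lt_one (by linarith)).2 h, le_rfl, ?_⟩
      have h1 : 1 - s * p / n = (n - s * p) / n := by field_simp
      rw [h1, ← mul_div_assoc, div_lt_iff₀ (by linarith)]
      nlinarith
    · have hA : 0 < (p - 1) * (p - q) / (2 * q) := by
        have : 0 < p - 1 := by linarith
        positivity
      have hA1 := min_le_left 1 ((p - 1) * (p - q) / (2 * q))
      have hA0 := lt_min one_pos hA
      refine ⟨1 - min 1 ((p - 1) * (p - q) / (2 * q)), by linarith, by linarith, ?_, ?_⟩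
      · have h1 : 1 ≤ s * p / n := (one_le_div (by linarith)).2 h
        linarith
      · rw [sub_sub_cancel]
        have h2 : 0 < (p - 1) * (p - q) := mul_pos (by linarith) hpq
        calc q * min 1 ((p - 1) * (p - q) / (2 * q)) ≤ q * ((p - 1) * (p - q) / (2 * q)) := by
              gcongr
              exact min_le_right _ _
          _ = (p - 1) * (p - q) / 2 := by field_simp
          _ < _ := by linarith
  obtain ⟨θ, hθ0, hθ1, hθn, hθq⟩ := hθ
  have hθc : 0 < 1 - θ := by linarith
  set ρ := (p - 1) * (p - q) / (q * (1 - θ)) with hρ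
  have hρ1 : 1 < ρ := (one_lt_div (by positivity)).2 hθq
  refine ⟨min 2 ((1 + ρ) / 2), θ, lt_min one_lt_two (by linarith), (min_le_left _ _).trans hp,
    hθ0, hθ1, hθn, ?_⟩
  rw [div_lt_div_iff₀ hpq hθc]
  have h3 : min 2 ((1 + ρ) / 2) < ρ := (min_le_right _ _).trans_lt (by linarith)
  rw [hρ, lt_div_iff₀ (by positivity)] at h3
  linarith

theorem integral_integral_congr_ae {n : ℕ} {a b : Rn n → ℝ} (h : a =ᵐ[volume] b)
    (F : ℝ → ℝ → Rn n → Rn n → ℝ) :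
    ∫ x, ∫ y, F (a x) (a y) x y = ∫ x, ∫ y, F (b x) (b y) x y := by
  refine integral_congr_ae (h.mono fun x hx => ?_)
  refine integral_congr_ae (h.mono fun y hy => ?_)
  simp only [hx, hy]

theorem lintegral_lintegral_congr_ae {n : ℕ} {a b : Rn n → ℝ} {ν : Measure (Rn n)} (h : a =ᵐ[ν] b)
    (F : ℝ → ℝ → Rn n → Rn n → ℝ≥0∞) :
    ∫⁻ x, ∫⁻ y, F (a x) (a y) x y ∂ν ∂ν = ∫⁻ x, ∫⁻ y, F (b x) (b y) x y ∂ν ∂ν := by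
  refine lintegral_congr_ae (h.mono fun x hx => ?_)
  refine lintegral_congr_ae (h.mono fun y hy => ?_)
  simp only [hx, hy]

theorem exists_comparison_const {n : ℕ} {s p Λ δ : ℝ} (hn : 2 ≤ n) (hs : 0 < s) (hs1 : s < 1)
    (hp2 : 2 ≤ p) (hΛ : 1 ≤ Λ) (hδ : 0 < δ) :
    ∃ C : ℝ, 0 < C ∧ ∀ h q : ℝ, 0 < h → h ≤ s - δ → 1 ≤ q → q ≤ qBar n s p - δ →
      ∀ (Kt : Rn n → Rn n → ℝ) (μ u v : Rn n → ℝ) (x₀ : Rn n) (r : ℝ),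
        SymKernel n Λ s p Kt → Integrable μ → 0 < r →
        WeakSolP n Kt s p (ball x₀ (2 * r)) μ u →
        WeakSolP n Kt s p (ball x₀ r) (fun _ => 0) v →
        (∀ᵐ x : Rn n, x ∉ ball x₀ r → v x = u x) →
        ((volume (ball x₀ r))⁻¹ *
            ∫⁻ x in ball x₀ r, ∫⁻ y in ball x₀ r,
              ENNReal.ofReal
                (|(u x - v x) - (u y - v y)| ^ q /
                  ‖x - y‖ ^ ((n : ℝ) + h * q))) ^ (1 / q) ≤
          ENNReal.ofReal (C / r ^ h) *
            ENNReal.ofReal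
              (((∫ x in ball x₀ r, |μ x|) / r ^ ((n : ℝ) - s * p)) ^ (1 / (p - 1))) := by
  classical
  rcases lt_or_ge (qBar n s p - δ) 1 with hlt | hq'
  · exact ⟨1, one_pos, fun h q _ _ hq hqq => absurd (hq.trans hqq) (not_le.2 hlt)⟩
  obtain ⟨ξ, θ, hξ, hξp, hθ0, hθ1, hθn, hγ⟩ := exists_exponents hn hs hs1 hp2 hq'
    (by linarith : qBar n s p - δ < qBar n s p)
  have hqp : qBar n s p - δ < p := by
    have : qBar n s p ≤ p := min_le_right _ _
    linarith
  have hΛ0 : 0 < Λ := by linarith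
  have hp0 : 0 < p := by linarith
  obtain ⟨C, hC, H⟩ := exists_fractional_le_ball (C₁ := Λ * 2 ^ (p - 1) / (ξ - 1)) hn hs hp0 hξ
    hξp hθ0 hθ1 hθn hq' hqp hγ hδ (by have := sub_pos.2 hξ; positivity)
  refine ⟨C, hC, fun h q hh hhs hq hqq Kt μ u v x₀ r hK hμ hr hu hv hvu => ?_⟩
  obtain ⟨⟨huM, -, huE⟩, huW⟩ := hu
  obtain ⟨⟨hvM, -, hvE⟩, hvW⟩ := hv
  obtain ⟨⟨hKm, hKb⟩, -⟩ := hK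
  simp only [gagliardo, Measure.restrict_univ] at huM hvM huE hvE
  set u' := huM.mk u with hu'
  have huu' : u =ᵐ[volume] u' := huM.ae_eq_mk
  set v' := (ball x₀ r).piecewise (hvM.mk v) u' with hv'
  have hvv' : v =ᵐ[volume] v' := by
    filter_upwards [hvM.ae_eq_mk, huu', hvu] with x h1 h2 h3
    by_cases hx : x ∈ ball x₀ r
    · rw [hv', Set.piecewise_eq_of_mem _ _ _ hx, h1]
    · rw [hv', Set.piecewise_eq_of_notMem _ _ _ hx, h3 hx, h2]
  have hu'm : Measurable u' := huM.measurable_mk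
  have hv'm : Measurable v' := hvM.measurable_mk.piecewise measurableSet_ball hu'm
  have hw0 : ∀ x, x ∉ ball x₀ r → u' x - v' x = 0 := fun x hx => by
    rw [hv', Set.piecewise_eq_of_notMem _ _ _ hx, sub_self]
  have hww : (fun x => u x - v x) =ᵐ[volume] fun x => u' x - v' x := huu'.sub hvv'
  have hγ0 : 0 ≤ (n : ℝ) + s * p := by positivity
  rw [lintegral_lintegral_congr_ae huu' (fun a b x y =>
    ENNReal.ofReal (|a - b| ^ p / ‖x - y‖ ^ ((n : ℝ) + s * p)))] at huE
  rw [lintegral_lintegral_congr_ae hvv' (fun a b x y =>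
    ENNReal.ofReal (|a - b| ^ p / ‖x - y‖ ^ ((n : ℝ) + s * p)))] at hvE
  have hball : ball x₀ r ⊆ ball x₀ (2 * r) := ball_subset_ball (by linarith)
  have hE := fun k (hk : 0 < k) => lintegral_weighted_energy_le (ξ := ξ) (u := u') (v := v')
    hp2 hΛ hγ0 hξ hr x₀ hKm (fun x y hxy => (hKb x y hxy).1) (fun x y hxy => (hKb x y hxy).2)
    hu'm hv'm hμ hw0 huE hvE
    (fun φ hφ => by
      rw [← huW φ ⟨hφ.1, hφ.2.1, hφ.2.2.trans hball⟩]
      exact (integral_integral_congr_ae huu' (fun a b x y =>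
        |a - b| ^ (p - 2) * (a - b) * (φ x - φ y) * Kt x y)).symm)
    (fun φ hφ => by
      have := hvW φ hφ
      simp only [mul_zero, integral_zero] at this
      rw [← this]
      exact (integral_integral_congr_ae hvv' (fun a b x y =>
        |a - b| ^ (p - 2) * (a - b) * (φ x - φ y) * Kt x y)).symm) hk
  rw [lintegral_lintegral_congr_ae (ae_restrict_of_ae hww) (fun a b x y =>
    ENNReal.ofReal (|a - b| ^ q / ‖x - y‖ ^ ((n : ℝ) + h * q)))]
  set M := ∫ x in ball x₀ r, |μ x| with hM
  have hM0 : 0 ≤ M := integral_nonneg fun x => abs_nonneg _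
  set d₀ := (M / r ^ ((n : ℝ) - s * p)) ^ (1 / (p - 1)) with hd₀
  have hd₀0 : 0 ≤ d₀ := by positivity
  have hd₀p : d₀ ^ (p - 1) * r ^ ((n : ℝ) - s * p) = M := by
    rw [hd₀, ← Real.rpow_mul (by positivity), one_div_mul_cancel (by linarith), Real.rpow_one,
      div_mul_cancel₀ _ (by positivity)]
  rw [← ENNReal.ofReal_mul (by positivity)]
  have hlim : Tendsto (fun d : ℝ => ENNReal.ofReal (C / r ^ h * d)) (𝓝[>] d₀)
      (𝓝 (ENNReal.ofReal (C / r ^ h * d₀))) :=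
    ((ENNReal.continuous_ofReal.comp (continuous_const_mul (C / r ^ h))).tendsto d₀).mono_left nhdsWithin_le_nhds
  refine ge_of_tendsto hlim (eventually_mem_nhdsWithin.mono fun d (hd : d₀ < d) => ?_)
  rw [ENNReal.ofReal_mul (by positivity)]
  refine H (fun x => u' x - v' x) x₀ r d M (hu'm.sub hv'm) hr (hd₀0.trans_lt hd) ?_ hw0 hE h q
    hh hhs hq hqq
  rw [← hd₀p]
  gcongr
  linarith

/-- Lemma 3.2, comparison estimate for fractional derivatives, `p ≥ 2`.
The constant `C δ`, with `δ = min {q̄ - q, s - h}`, depends only on `n, s, p, Λ, δ`. -/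
theorem comparison_estimate_grad_p_ge_two
    (n : ℕ) (s p Λ : ℝ)
    (hn : 2 ≤ n) (hs : 0 < s) (hs1 : s < 1) (hp2 : 2 ≤ p) (hΛ : 1 ≤ Λ) :
    ∃ C : ℝ → ℝ, (∀ δ : ℝ, 0 < δ → 0 < C δ) ∧
      ∀ h q : ℝ, 0 < h → h < s → 1 ≤ q → q < qBar n s p →
        ∀ (Kt : Rn n → Rn n → ℝ) (μ u v : Rn n → ℝ) (x₀ : Rn n) (r : ℝ),
          SymKernel n Λ s p Kt →
          ContDiff ℝ (⊤ : ℕ∞) μ → HasCompactSupport μ →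
          0 < r →
          WeakSolP n Kt s p (ball x₀ (2 * r)) μ u →
          WeakSolP n Kt s p (ball x₀ r) (fun _ => 0) v →
          (∀ᵐ x : Rn n, x ∉ ball x₀ r → v x = u x) →
          ((volume (ball x₀ r))⁻¹ *
              ∫⁻ x in ball x₀ r, ∫⁻ y in ball x₀ r,
                ENNReal.ofReal
                  (|(u x - v x) - (u y - v y)| ^ q /
                    ‖x - y‖ ^ ((n : ℝ) + h * q))) ^ (1 / q) ≤
            ENNReal.ofReal (C (min (qBar n s p - q) (s - h)) / r ^ h) *
              ENNReal.ofReal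
                (((∫ x in ball x₀ r, |μ x|) / r ^ ((n : ℝ) - s * p)) ^ (1 / (p - 1))) := by
  choose! C hC0 hC using fun δ (hδ : 0 < δ) =>
    exists_comparison_const (n := n) (s := s) (p := p) (Λ := Λ) (δ := δ) hn hs hs1 hp2 hΛ hδ
  refine ⟨C, hC0, fun h q hh hhs hq hqb Kt μ u v x₀ r hK hμ hμc hr hu hv hvu => ?_⟩
  have hδ : 0 < min (qBar n s p - q) (s - h) := lt_min (sub_pos.2 hqb) (sub_pos.2 hhs)
  exact hC _ hδ h q hh (by linarith [min_le_right (qBar n s p - q) (s - h)]) hq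
    (by linarith [min_le_left (qBar n s p - q) (s - h)]) Kt μ u v x₀ r hK
    (hμ.continuous.integrable_of_hasCompactSupport hμc) hr hu hv hvu
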